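/- Let (t,w) be a semifinite zigzag growth model. For ε > 0 let w_ε be the finite sequence of signed lengths obtained by traversing the splitting t = (a₀, t₁, a₁, …, t_k, a_k): each flange word a_j contributes, for each of its blocks, one interval of that block's sign with length ε, and each section t_i contributes the intervals v_i (the infinite clusters of t_i with their weights from w), in order. Let t' be the template of w_ε (replace each interval by an infinite cluster of its sign and insert a one-symbol cluster of the opposite sign between adjacent equal-sign infinite clusters); t' does not depend on ε. Then there exist a natural number n and a constant C > 0, depending only on (t,w), such that for every zigzag μ ∈ Z(t') with bw(μ) ≥ t[1], the limit lim_{ε→0⁺} ε^{−n} F_μ(w_ε) exists and φ_{t,w}(μ) = C · lim_{ε→0⁺} ε^{−n} F_μ(w_ε). -/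

import Mathlib

/-!
Common definitions: the zigzag graph on binary words, templates and their coideals,
zigzag flanges and sections, the functions `F_λ(u)` and `φ_{t,w}`, and harmonic /
semifinite / indecomposable functions on subgraphs of the zigzag graph.
-/

open scoped ENNReal NNReal

namespace Zigzag

/-- Binary words: `true` is `+`, `false` is `−`. -/
abbrev BW := List Bool

/-- `CoveredBy a b`: `b` covers `a` in the subword order, i.e. `|b| = |a| + 1` and `a`
is a subword of `b`; these are the edges of the zigzag graph. -/
def CoveredBy (a b : BW) : Prop := a.Sublist b ∧ b.length = a.length + 1

/-- The set of upper neighbours of `a` lying in `S` is finite. -/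
lemma upSet_finite (S : Set BW) (a : BW) : {b | b ∈ S ∧ CoveredBy a b}.Finite :=
  (List.finite_length_eq Bool (a.length + 1)).subset (fun _ hb => hb.2.2)

/-- The finset of upper neighbours of `a` inside `S`. -/
noncomputable def upFinset (S : Set BW) (a : BW) : Finset BW :=
  (upSet_finite S a).toFinset

/-- A `[0,∞]`-valued function is harmonic on `S ⊆ Z` (with the edges induced from the
zigzag graph) if its value at any vertex of `S` equals the sum of its values at the
upper neighbours lying in `S`. -/
def HarmonicOn (S : Set BW) (φ : BW → ℝ≥0∞) : Prop :=
  ∀ a ∈ S, φ a = ∑ b ∈ upFinset S a, φ b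

/-- A template: a nonempty sequence of clusters with alternating signs, each cluster
being a sign (`true` = `+`, `false` = `−`) with a multiplicity in `{1,2,…} ∪ {∞}`,
containing at least one infinite cluster. -/
structure Template where
  clusters : List (Bool × ℕ∞)
  ne : clusters ≠ []
  pos : ∀ c ∈ clusters, c.2 ≠ 0
  alternating : clusters.Chain' fun c d => c.1 ≠ d.1
  hasInf : ∃ c ∈ clusters, c.2 = ⊤

/-- The binary word obtained from a list of clusters by replacing every infinite
multiplicity by `N` (and keeping the finite multiplicities). -/
def clWord (cs : List (Bool × ℕ∞)) (N : ℕ) : BW :=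
  (cs.map fun c => List.replicate (if c.2 = ⊤ then N else c.2.toNat) c.1).flatten

/-- The coideal generated by a list of clusters: all binary words that are subwords of
some instantiation. -/
def Zcl (cs : List (Bool × ℕ∞)) : Set BW := {a | ∃ N, a.Sublist (clWord cs N)}

/-- The coideal `Z(t)` of the zigzag graph attached to a template `t`. -/
def Zt (t : Template) : Set BW := Zcl t.clusters

/-- The cluster in position `i` of `t` is a separating cluster: a one-symbol finite
cluster which is not outermost and whose two neighbours are infinite clusters
(necessarily of the same sign). -/
def Template.isSep (t : Template) (i : ℕ) : Prop :=
  0 < i ∧ i + 1 < t.clusters.length ∧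
  (t.clusters.getD i (true, 1)).2 = 1 ∧
  (t.clusters.getD (i - 1) (true, 1)).2 = ⊤ ∧
  (t.clusters.getD (i + 1) (true, 1)).2 = ⊤

/-- A template is finite if all its finite clusters are separating; otherwise it is
semifinite. -/
def Template.IsFiniteTemplate (t : Template) : Prop :=
  ∀ i < t.clusters.length, (t.clusters.getD i (true, 1)).2 ≠ ⊤ → t.isSep i

/-- The number of infinite clusters of a template. -/
def Template.numInf (t : Template) : ℕ :=
  (t.clusters.filter fun c => decide (c.2 = ⊤)).length

/-- Position `p` of `t` carries a finite non-separating cluster, i.e. a cluster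
contributing to the zigzag flange of `t`. -/
def IsFlangePos (t : Template) (p : ℕ) : Prop :=
  p < t.clusters.length ∧ (t.clusters.getD p (true, 1)).2 ≠ ⊤ ∧ ¬t.isSep p

/-- Decrease by one the multiplicity of the cluster in position `p`. -/
def decAt (cs : List (Bool × ℕ∞)) (p : ℕ) : List (Bool × ℕ∞) :=
  cs.set p ((cs.getD p (true, 1)).1, (cs.getD p (true, 1)).2 - 1)

/-- The coideal `J(t)`: the union of the coideals `Z(r)` over all `r` obtained from `t`
by removing a single symbol from a cluster corresponding to a block of a binary word
from the zigzag flange of `t` (no merging of clusters is needed to generate `Z(r)`). -/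
def Jt (t : Template) : Set BW :=
  {a | ∃ p, IsFlangePos t p ∧ a ∈ Zcl (decAt t.clusters p)}

/-- The canonical splitting of a template `t` into its zigzag flange
`fl(t) = (a₀, …, a_k)` (given by the lists `A 0, …, A k` of clusters, each consisting
of finite non-separating clusters of `t`) and its sections `t₁, …, t_k` (the maximal
groups of consecutive clusters forming finite templates), so that
`t = (a₀, t₁, a₁, …, a_{k−1}, t_k, a_k)`.  The two `interior` conditions express the
maximality of the decomposition. -/
structure SectionData (t : Template) where
  k : ℕ
  A : Fin (k + 1) → List (Bool × ℕ∞)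
  T : Fin k → Template
  concat : t.clusters
      = A 0 ++ (List.ofFn fun i : Fin k => (T i).clusters ++ A i.succ).flatten
  finA : ∀ j, ∀ c ∈ A j, c.2 ≠ ⊤
  secFin : ∀ i, (T i).IsFiniteTemplate
  interior_ne : ∀ j : Fin (k + 1), (j : ℕ) ≠ 0 → (j : ℕ) ≠ k → A j ≠ []
  interior_not_sep : ∀ j : Fin (k + 1), (j : ℕ) ≠ 0 → (j : ℕ) ≠ k →
      ∀ s : Bool, A j ≠ [(s, 1)]

/-- The binary word corresponding to a list of finite clusters (a flange word). -/
def flangeWord (cs : List (Bool × ℕ∞)) : BW :=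
  (cs.map fun c => List.replicate c.2.toNat c.1).flatten

/-- `a₀ ⊔ ℓ 1 ⊔ a₁ ⊔ … ⊔ ℓ k ⊔ a_k` (empty flange words disappear). -/
def assemble {t : Template} (D : SectionData t) (ℓ : Fin D.k → BW) : BW :=
  flangeWord (D.A 0) ++ (List.ofFn fun i : Fin D.k => ℓ i ++ flangeWord (D.A i.succ)).flatten

/-- `ℓ` is a decomposition of `a` along the sections of `t`:
`bw(a) = a₀ ⊔ bw(ℓ 1) ⊔ a₁ ⊔ … ⊔ bw(ℓ k) ⊔ a_k` with `ℓ i ∈ Z(tᵢ)`. -/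
def decompOf {t : Template} (D : SectionData t) (a : BW) (ℓ : Fin D.k → BW) : Prop :=
  (∀ i, ℓ i ∈ Zt (D.T i)) ∧ a = assemble D ℓ

/-- The signs of the infinite clusters of a list of clusters, in order. -/
def infSigns (cs : List (Bool × ℕ∞)) : List Bool :=
  (cs.filter fun c => decide (c.2 = ⊤)).map Prod.fst

/-- The number of weights consumed by the sections preceding the `i`-th one. -/
def secOffset {t : Template} (D : SectionData t) (i : Fin D.k) : ℕ :=
  ∑ i' ∈ Finset.univ.filter (· < i), (infSigns (D.T i').clusters).length

/-- The part `vᵢ` of the tuple of weights `w` corresponding to the infinite clusters of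
the `i`-th section, as a sequence of (sign, weight) pairs. -/
def vD {t : Template} (D : SectionData t) (w : List ℝ) (i : Fin D.k) : List (Bool × ℝ) :=
  (infSigns (D.T i).clusters).zip (w.drop (secOffset D i))

/-- `F_λ(u)` for a finite sequence `u` of (sign, length) pairs and a zigzag `λ`
(encoded by its binary word `a`, so that `λ` has `a.length + 1` boxes): the sum, over
all decompositions of `λ` into `u.length` consecutive (possibly empty) zigzags
`λ(1), …, λ(m)` with `λ(i)` a row when the `i`-th sign is `+` and a column when it is
`−`, of `u₁ ^ |λ(1)| ⋯ u_m ^ |λ(m)|`.  A decomposition is recorded by the tuple `c` of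
the numbers of boxes of the pieces; the row/column constraint says that the letters of
`a` strictly inside the `i`-th group of boxes all equal the `i`-th sign. -/
noncomputable def Fword (u : List (Bool × ℝ)) (a : BW) : ℝ :=
  ∑ c ∈ (Finset.Nat.antidiagonalTuple u.length (a.length + 1)).filter
      (fun c => ∀ i : Fin u.length,
        (a.drop (∑ i' ∈ Finset.univ.filter (· < i), c i')).take (c i - 1)
          = List.replicate (c i - 1) (u.get i).1),
    ∏ i, (u.get i).2 ^ c i

open Classical in
/-- The function `φ_{t,w}` attached to a semifinite zigzag growth model `(t, w)`:
it equals `+∞` on `J(t)`, and on `Z(t) ∖ J(t)` it equals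
`F_{λ^{(1)}}(v₁) ⋯ F_{λ^{(k)}}(v_k)`, where `(λ^{(1)}, …, λ^{(k)})` is the (unique)
decomposition of `λ` along the sections of `t` (it is `0` off `Z(t)`). -/
noncomputable def phiTW (t : Template) (D : SectionData t) (w : List ℝ) (a : BW) : ℝ≥0∞ :=
  if a ∉ Zt t then 0
  else if a ∈ Jt t then ⊤
  else if h : ∃ ℓ : Fin D.k → BW, decompOf D a ℓ then
    ENNReal.ofReal (∏ i, Fword (vD D w i) (h.choose i))
  else 0

section Kcone

/-- The relation `λ = ∑_{μ : λ ↗ μ} μ` (within `S`) as an element of the free module. -/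
noncomputable def relOf (S : Set BW) (a : BW) : BW →₀ ℝ :=
  Finsupp.single a 1 - ∑ b ∈ upFinset S a, Finsupp.single b 1

/-- The submodule of relations defining `K(S)`. -/
noncomputable def Krel (S : Set BW) : Submodule ℝ (BW →₀ ℝ) :=
  Submodule.span ℝ {f | ∃ a ∈ S, f = relOf S a}

/-- The class of `f` in `K(S) = (⊕_{λ ∈ S} ℝ λ) ⧸ (relations)`. -/
noncomputable def kmk (S : Set BW) (f : BW →₀ ℝ) : (BW →₀ ℝ) ⧸ Krel S :=
  Submodule.Quotient.mk f

/-- Nonnegative formal combinations of vertices of `S`. -/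
def NonnegOn (S : Set BW) (f : BW →₀ ℝ) : Prop :=
  (∀ x, 0 ≤ f x) ∧ ∀ x ∈ f.support, x ∈ S

/-- The cone `K⁺(S)` spanned by the vertices of `S` in `K(S)`. -/
noncomputable def Kpos (S : Set BW) : Set ((BW →₀ ℝ) ⧸ Krel S) :=
  kmk S '' {f | NonnegOn S f}

/-- The order defined by the cone `K⁺(S)`: `x ≤_K y` iff `y − x ∈ K⁺(S)`. -/
def leK (S : Set BW) (x y : (BW →₀ ℝ) ⧸ Krel S) : Prop := y - x ∈ Kpos S

/-- The value of (the canonical extension of) `φ` at a nonnegative combination of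
vertices. -/
noncomputable def phiHat (φ : BW → ℝ≥0∞) (f : BW →₀ ℝ) : ℝ≥0∞ :=
  ∑ x ∈ f.support, ENNReal.ofReal (f x) * φ x

/-- `φ` is finite on `S`. -/
def FiniteOn (S : Set BW) (φ : BW → ℝ≥0∞) : Prop := ∀ a ∈ S, φ a ≠ ⊤

/-- `φ` is a semifinite function on (the graph) `S`: it is not everywhere finite, and
its value at any element `a` of the cone `K⁺` is the supremum of its values at the
elements `b ≤_K a` of the cone where it is finite. -/
def SemifiniteOn (S : Set BW) (φ : BW → ℝ≥0∞) : Prop :=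
  (∃ a ∈ S, φ a = ⊤) ∧
  ∀ f : BW →₀ ℝ, NonnegOn S f →
    phiHat φ f =
      ⨆ g ∈ {g : BW →₀ ℝ |
        NonnegOn S g ∧ leK S (kmk S g) (kmk S f) ∧ phiHat φ g ≠ ⊤}, phiHat φ g

/-- A semifinite harmonic function `φ` on `S` is indecomposable if any finite or
semifinite harmonic function `φ′ ≤ φ` on `S` which does not vanish identically on the
finiteness ideal of `φ` is a constant multiple of `φ` on that ideal. -/
def IndecSemifiniteOn (S : Set BW) (φ : BW → ℝ≥0∞) : Prop :=
  ∀ φ' : BW → ℝ≥0∞, HarmonicOn S φ' →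
    (FiniteOn S φ' ∨ SemifiniteOn S φ') →
    (∀ a ∈ S, φ' a ≤ φ a) →
    (∃ a ∈ S, φ a ≠ ⊤ ∧ φ' a ≠ 0) →
    ∃ c : ℝ≥0, ∀ a ∈ S, φ a ≠ ⊤ → φ' a = (c : ℝ≥0∞) * φ a

end Kcone

end Zigzag

namespace Zigzag

/-- The template of a finite sequence of oriented intervals: replace each interval by
an infinite cluster of its sign and insert a one-symbol cluster of the opposite sign
between any two adjacent infinite clusters of equal sign. -/
def tuClusters : List (Bool × ℝ) → List (Bool × ℕ∞)
  | [] => []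
  | [(s, _)] => [(s, ⊤)]
  | (s, _) :: (s', x) :: rest =>
      if s = s' then (s, ⊤) :: (!s, 1) :: tuClusters ((s', x) :: rest)
      else (s, ⊤) :: tuClusters ((s', x) :: rest)

/-- The collection `w_ε` of adjacent oriented intervals obtained by traversing the
splitting `t = (a₀, t₁, a₁, …, t_k, a_k)`: every cluster of a flange word contributes
one interval of its sign with length `ε`, and each section `tᵢ` contributes the
intervals `vᵢ` (the signs of its infinite clusters with their weights from `w`). -/
def weps {t : Template} (D : SectionData t) (w : List ℝ) (ε : ℝ) : List (Bool × ℝ) :=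
  ((D.A 0).map fun c => (c.1, ε)) ++
    (List.ofFn fun i : Fin D.k =>
      vD D w i ++ ((D.A i.succ).map fun c => (c.1, ε))).flatten

/-- The word `s₁^{m₁} s₂^{m₂} ⋯` of a list of pairs (sign, multiplicity). -/
def blockWord (S : List (Bool × ℕ)) : BW := (S.map fun c => List.replicate c.2 c.1).flatten

@[simp] lemma blockWord_nil : blockWord [] = [] := rfl

@[simp] lemma blockWord_cons (c : Bool × ℕ) (S : List (Bool × ℕ)) :
    blockWord (c :: S) = List.replicate c.2 c.1 ++ blockWord S := by
  simp [blockWord]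

lemma blockWord_append (S S' : List (Bool × ℕ)) :
    blockWord (S ++ S') = blockWord S ++ blockWord S' := by
  simp [blockWord]

/-- `y` is a word of the form `σ₁^{q₁} σ₂^{q₂} ⋯` with multiplicities `qᵢ ≥ 0`. -/
def FitsSigns (σ : List Bool) (y : BW) : Prop :=
  ∃ S : List (Bool × ℕ), S.map Prod.fst = σ ∧ y = blockWord S

lemma FitsSigns.of_sublist {S : List (Bool × ℕ)} {y : BW} (h : y.Sublist (blockWord S)) :
    FitsSigns (S.map Prod.fst) y := by
  induction S generalizing y with
  | nil => exact ⟨[], by simpa using h⟩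
  | cons c S ih =>
    rw [blockWord_cons, List.sublist_append_iff] at h
    obtain ⟨l₁, l₂, rfl, h₁, h₂⟩ := h
    obtain ⟨n, -, rfl⟩ := List.sublist_replicate_iff.1 h₁
    obtain ⟨S', hS', rfl⟩ := ih h₂
    exact ⟨(c.1, n) :: S', by simp [hS'], by simp⟩

lemma FitsSigns.append {σ σ' : List Bool} {y y' : BW} (h : FitsSigns σ y) (h' : FitsSigns σ' y') :
    FitsSigns (σ ++ σ') (y ++ y') := by
  obtain ⟨S, rfl, rfl⟩ := h
  obtain ⟨S', rfl, rfl⟩ := h'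
  exact ⟨S ++ S', by simp, (blockWord_append _ _).symm⟩

lemma FitsSigns.flatten_ofFn {k : ℕ} {σ : Fin k → List Bool} {y : Fin k → BW}
    (h : ∀ i, FitsSigns (σ i) (y i)) :
    FitsSigns (List.ofFn σ).flatten (List.ofFn y).flatten := by
  induction k with
  | zero => exact ⟨[], by simp⟩
  | succ k ih =>
    simp only [List.ofFn_succ, List.flatten_cons]
    exact (h 0).append (ih fun i => h i.succ)

/-- A prefix of one letter blocks off the first cluster: if `s^m X ≤ s'^q Y` where `X` starts
with a letter other than `s`, then `X ≤ Y`. -/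
lemma sublist_of_replicate_append {s s' : Bool} {m q : ℕ} {X Y : BW} (hm : 0 < m)
    (hX : ∀ x ∈ X.head?, x ≠ s)
    (h : (List.replicate m s ++ X).Sublist (List.replicate q s' ++ Y)) : X.Sublist Y := by
  rw [List.sublist_append_iff] at h
  obtain ⟨l₁, l₂, e, h₁, h₂⟩ := h
  obtain ⟨n, -, rfl⟩ := List.sublist_replicate_iff.1 h₁
  rcases List.append_eq_append_iff.1 e with ⟨a, ha, rfl⟩ | ⟨a, -, rfl⟩
  · cases a with
    | nil => simpa using h₂
    | cons x a =>
      have hx : x ≠ s := by simpa using hX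
      have h1 : x ∈ List.replicate n s' := by rw [ha]; simp
      have h2 : s ∈ List.replicate n s' := by rw [ha]; simp; omega
      exact absurd ((List.mem_replicate.1 h1).2.trans (List.mem_replicate.1 h2).2.symm) hx
  · exact (List.sublist_append_right _ _).trans h₂

lemma head?_blockWord {S : List (Bool × ℕ)} (hpos : ∀ c ∈ S, 0 < c.2) :
    (blockWord S).head? = (S.map Prod.fst).head? := by
  cases S with
  | nil => rfl
  | cons c S =>
    obtain ⟨n, hn⟩ := Nat.exists_eq_succ_of_ne_zero (hpos c (by simp)).ne'
    simp [hn, List.replicate_succ]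

/-- A word with alternating nonempty blocks is not a subword of a word with fewer blocks. -/
lemma length_le_of_blockWord_sublist {S S' : List (Bool × ℕ)} (hpos : ∀ c ∈ S, 0 < c.2)
    (halt : (S.map Prod.fst).IsChain (· ≠ ·)) (h : (blockWord S).Sublist (blockWord S')) :
    S.length ≤ S'.length := by
  induction S' generalizing S with
  | nil =>
    cases S with
    | nil => simp
    | cons c S => have := hpos c (by simp); simp at h; omega
  | cons c' S' ih =>
    cases S with
    | nil => simp
    | cons c S =>
      rw [List.map_cons, List.isChain_cons] at halt
      have hposS : ∀ c ∈ S, 0 < c.2 := fun c hc => hpos c (by simp [hc])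
      have := ih hposS halt.2 (sublist_of_replicate_append (hpos c (by simp)) (by
        rw [head?_blockWord hposS]
        exact fun x hx => (halt.1 x hx).symm) (by simpa using h))
      simpa using this

/-- If an alternating word with nonempty blocks is a subword of a word with the same sequence
of block signs, then the block sizes are dominated one by one. -/
lemma forall₂_le_of_blockWord_sublist {S S' : List (Bool × ℕ)} (hpos : ∀ c ∈ S, 0 < c.2)
    (halt : (S.map Prod.fst).IsChain (· ≠ ·)) (hsgn : S.map Prod.fst = S'.map Prod.fst)
    (h : (blockWord S).Sublist (blockWord S')) :
    List.Forall₂ (fun c c' : Bool × ℕ => c.1 = c'.1 ∧ c.2 ≤ c'.2) S S' := by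
  induction S generalizing S' with
  | nil =>
    have : S' = [] := by simpa using hsgn.symm
    simp [this]
  | cons c S ih =>
    cases S' with
    | nil => simp at hsgn
    | cons c' S' =>
      simp only [List.map_cons, List.cons.injEq] at hsgn
      have halt' := halt
      rw [List.map_cons, List.isChain_cons] at halt'
      have hposS : ∀ c ∈ S, 0 < c.2 := fun c hc => hpos c (by simp [hc])
      have hX : ∀ x ∈ (blockWord S).head?, x ≠ c.1 := by
        rw [head?_blockWord hposS]
        exact fun x hx => (halt'.1 x hx).symm
      simp only [blockWord_cons] at h
      refine List.Forall₂.cons ⟨hsgn.1, ?_⟩ (ih hposS halt'.2 hsgn.2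
        (sublist_of_replicate_append (hpos c (by simp)) hX h))
      by_contra! hlt
      obtain ⟨d, hd⟩ := Nat.exists_eq_add_of_lt hlt
      have e : List.replicate c.2 c.1 = List.replicate c'.2 c'.1 ++ List.replicate (d + 1) c.1 := by
        rw [← hsgn.1, List.replicate_append_replicate, hd, add_assoc]
      rw [e, List.append_assoc, List.append_sublist_append_left] at h
      have := length_le_of_blockWord_sublist (S := (c.1, d + 1) :: S) (S' := S')
        (by simpa using fun a b hab => hposS (a, b) hab) (by simpa using halt) (by simpa using h)
      have hlen := congrArg List.length hsgn.2
      simp only [List.length_map, List.length_cons] at this hlen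
      omega

lemma blockWord_sublist_of_forall₂ {S S' : List (Bool × ℕ)}
    (h : List.Forall₂ (fun c c' : Bool × ℕ => c.1 = c'.1 ∧ c.2 ≤ c'.2) S S') :
    (blockWord S).Sublist (blockWord S') := by
  induction h with
  | nil => simp
  | cons h _ ih =>
    simp only [blockWord_cons, h.1]
    exact (List.replicate_sublist_replicate _ |>.2 h.2).append ih

lemma forall₂_append_split {α β : Type*} {R : α → β → Prop} {a a' : List α} {b b' : List β}
    (hl : a.length = b.length) (h : List.Forall₂ R (a ++ a') (b ++ b')) :
    List.Forall₂ R a b ∧ List.Forall₂ R a' b' := by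
  induction a generalizing b with
  | nil =>
    have : b = [] := by simpa using hl.symm
    subst this
    simpa using h
  | cons x a ih =>
    cases b with
    | nil => simp at hl
    | cons y b =>
      simp only [List.cons_append, List.forall₂_cons] at h ⊢
      have := ih (by simpa using hl) h.2
      exact ⟨⟨h.1, this.1⟩, this.2⟩

lemma blockWord_sublist_append {S₁ S₂ : List (Bool × ℕ)} {y₁ y₂ : BW}
    (hpos : ∀ c ∈ S₁ ++ S₂, 0 < c.2) (halt : ((S₁ ++ S₂).map Prod.fst).IsChain (· ≠ ·))
    (h₁ : FitsSigns (S₁.map Prod.fst) y₁) (h₂ : FitsSigns (S₂.map Prod.fst) y₂)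
    (h : (blockWord S₁ ++ blockWord S₂).Sublist (y₁ ++ y₂)) :
    (blockWord S₁).Sublist y₁ ∧ (blockWord S₂).Sublist y₂ := by
  obtain ⟨Q₁, e₁, rfl⟩ := h₁
  obtain ⟨Q₂, e₂, rfl⟩ := h₂
  rw [← blockWord_append, ← blockWord_append] at h
  have := forall₂_le_of_blockWord_sublist hpos halt (by simp [e₁, e₂]) h
  have := forall₂_append_split (by simpa using (congrArg List.length e₁).symm) this
  exact ⟨blockWord_sublist_of_forall₂ this.1, blockWord_sublist_of_forall₂ this.2⟩

lemma map_flatten_ofFn {α β : Type*} {k : ℕ} (f : α → β) (S : Fin k → List α) :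
    (List.ofFn S).flatten.map f = (List.ofFn fun i => (S i).map f).flatten := by
  rw [List.map_flatten, List.map_ofFn]; rfl

lemma blockWord_flatten_ofFn {k : ℕ} (S : Fin k → List (Bool × ℕ)) :
    blockWord (List.ofFn S).flatten = (List.ofFn fun i => blockWord (S i)).flatten := by
  induction k with
  | zero => simp
  | succ k ih => simp only [List.ofFn_succ, List.flatten_cons, blockWord_append, ih]

lemma blockWord_sublist_of_flatten {k : ℕ} {S : Fin k → List (Bool × ℕ)} {y : Fin k → BW}
    (hpos : ∀ c ∈ (List.ofFn S).flatten, 0 < c.2)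
    (halt : ((List.ofFn S).flatten.map Prod.fst).IsChain (· ≠ ·))
    (hfit : ∀ i, FitsSigns ((S i).map Prod.fst) (y i))
    (h : (blockWord (List.ofFn S).flatten).Sublist (List.ofFn y).flatten) (i : Fin k) :
    (blockWord (S i)).Sublist (y i) := by
  induction k with
  | zero => exact i.elim0
  | succ k ih =>
    simp only [List.ofFn_succ, List.flatten_cons, blockWord_append] at h hpos halt
    have hrest : FitsSigns ((List.ofFn fun i => S (Fin.succ i)).flatten.map Prod.fst)
        (List.ofFn fun i => y (Fin.succ i)).flatten := by
      rw [map_flatten_ofFn]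
      exact FitsSigns.flatten_ofFn fun i => hfit i.succ
    have key := blockWord_sublist_append hpos halt (hfit 0) hrest h
    rw [List.map_append, List.isChain_append] at halt
    refine Fin.cases key.1 (fun i => ?_) i
    exact ih (fun c hc => hpos c (List.mem_append_right _ hc)) halt.2.1 (fun i => hfit i.succ)
      key.2 i

lemma exists_of_sublist_flatten_ofFn {α : Type*} {k : ℕ} {f : Fin k → List α} {y : List α}
    (h : y.Sublist (List.ofFn f).flatten) :
    ∃ y' : Fin k → List α, y = (List.ofFn y').flatten ∧ ∀ i, (y' i).Sublist (f i) := by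
  induction k generalizing y with
  | zero => exact ⟨Fin.elim0, by simpa using h, fun i => i.elim0⟩
  | succ k ih =>
    simp only [List.ofFn_succ, List.flatten_cons, List.sublist_append_iff] at h
    obtain ⟨l₁, l₂, rfl, h₁, h₂⟩ := h
    obtain ⟨y', rfl, hy⟩ := ih h₂
    exact ⟨Fin.cons l₁ y', by simp [List.ofFn_succ], Fin.cases h₁ hy⟩

/-- The sum `F_λ(u)` with the number `N` of boxes decoupled from the length of the word, so
that it also makes sense for the empty zigzag. -/
noncomputable def boxSum (u : List (Bool × ℝ)) (a : BW) (N : ℕ) : ℝ :=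
  ∑ c ∈ (Finset.Nat.antidiagonalTuple u.length N).filter
      (fun c => ∀ i : Fin u.length,
        (a.drop (∑ i' ∈ Finset.univ.filter (· < i), c i')).take (c i - 1)
          = List.replicate (c i - 1) (u.get i).1),
    ∏ i, (u.get i).2 ^ c i

lemma boxSum_nil (a : BW) (N : ℕ) : boxSum [] a N = if N = 0 then 1 else 0 := by
  cases N <;> simp [boxSum]

lemma sum_filter_lt_succ {n : ℕ} (c : Fin (n + 1) → ℕ) (i : Fin n) :
    ∑ i' ∈ Finset.univ.filter (· < i.succ), c i'
      = c 0 + ∑ i' ∈ Finset.univ.filter (· < i), c i'.succ := by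
  simp [Finset.sum_filter, Fin.sum_univ_succ]

lemma sum_antidiagonalTuple_succ {M : Type*} [AddCommMonoid M] (k N : ℕ)
    (f : (Fin (k + 1) → ℕ) → M) :
    ∑ c ∈ Finset.Nat.antidiagonalTuple (k + 1) N, f c
      = ∑ j ∈ Finset.range (N + 1), ∑ c ∈ Finset.Nat.antidiagonalTuple k (N - j),
          f (Fin.cons j c) := by
  rw [Finset.sum_sigma']
  refine Finset.sum_bij' (fun c _ => ⟨c 0, Fin.tail c⟩) (fun p _ => Fin.cons p.1 p.2)
    ?_ ?_ ?_ ?_ ?_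
  · intro c hc
    rw [Finset.Nat.mem_antidiagonalTuple, Fin.sum_univ_succ] at hc
    simp only [Finset.mem_sigma, Finset.mem_range, Finset.Nat.mem_antidiagonalTuple, Fin.tail]
    omega
  · rintro ⟨j, c⟩ hc
    simp only [Finset.mem_sigma, Finset.mem_range, Finset.Nat.mem_antidiagonalTuple] at hc
    simp only [Finset.Nat.mem_antidiagonalTuple, Fin.sum_univ_succ, Fin.cons_zero, Fin.cons_succ]
    omega
  · intro c _; simp
  · rintro ⟨j, c⟩ _; simp
  · intro c _; simp

/-- Splitting off the first group of boxes. -/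
lemma boxSum_cons (s : Bool) (x : ℝ) (u : List (Bool × ℝ)) (a : BW) (N : ℕ) :
    boxSum ((s, x) :: u) a N = ∑ j ∈ Finset.range (N + 1),
      if a.take (j - 1) = List.replicate (j - 1) s then x ^ j * boxSum u (a.drop j) (N - j)
      else 0 := by
  unfold boxSum
  rw [Finset.sum_filter]
  simp only [List.length_cons]
  rw [sum_antidiagonalTuple_succ]
  refine Finset.sum_congr rfl fun j _ => ?_
  simp only [Fin.forall_fin_succ, Fin.prod_univ_succ, sum_filter_lt_succ, Fin.cons_zero,
    Fin.cons_succ, List.get_cons_zero, List.get_cons_succ', Fin.not_lt_zero, Finset.filter_false,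
    Finset.sum_empty, List.drop_zero]
  split_ifs with h
  · simp [h, Finset.sum_filter, Finset.mul_sum]
  · simp [h]

/-- The number of sign changes of the word `a` preceded by the letter `s`. -/
def signChanges : Bool → BW → ℕ
  | _, [] => 0
  | s, l :: a => (if l = s then 0 else 1) + signChanges l a

lemma signChanges_le (s s' : Bool) (a : BW) :
    signChanges s a ≤ (if s = s' then 0 else 1) + signChanges s' a := by
  cases a with
  | nil => simp [signChanges]
  | cons l a => simp only [signChanges]; cases l <;> cases s <;> cases s' <;> simp <;> omega

lemma signChanges_replicate_append (s : Bool) (n : ℕ) (a : BW) :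
    signChanges s (List.replicate n s ++ a) = signChanges s a := by
  induction n with
  | zero => simp
  | succ n ih => simp [List.replicate_succ, signChanges, ih]

/-- The number of sign changes a word can have and still be distributed over a sequence of
intervals that continues an interval of sign `s`. -/
def maxChanges : Bool → List (Bool × ℝ) → ℕ
  | _, [] => 0
  | s, (s', _) :: u => (if s = s' then 2 else 1) + maxChanges s' u

/-- `F_λ(u)` vanishes for words with too many sign changes. -/
lemma boxSum_eq_zero {s : Bool} {x : ℝ} {u : List (Bool × ℝ)} {a : BW}
    (h : maxChanges s u < signChanges s a) : boxSum ((s, x) :: u) a (a.length + 1) = 0 := by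
  induction u generalizing s x a with
  | nil =>
    rw [boxSum_cons]
    refine Finset.sum_eq_zero fun j hj => ?_
    rw [Finset.mem_range] at hj
    split_ifs with ht
    · rw [boxSum_nil, if_neg, mul_zero]
      intro h0
      have hj' : j = a.length + 1 := by omega
      subst hj'
      simp only [Nat.add_sub_cancel, List.take_length] at ht
      have := signChanges_replicate_append s a.length []
      rw [List.append_nil, ← ht] at this
      simp [this, signChanges] at h
    · rfl
  | cons p u ih =>
    obtain ⟨s', x'⟩ := p
    rw [boxSum_cons]
    refine Finset.sum_eq_zero fun j hj => ?_
    rw [Finset.mem_range] at hj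
    split_ifs with ht
    · rcases Nat.eq_zero_or_pos j with rfl | hj0
      · have := signChanges_le s s' a
        simp only [maxChanges] at h
        rw [List.drop_zero, Nat.sub_zero, ih, mul_zero]
        split_ifs at * <;> omega
      · obtain ⟨j, rfl⟩ := Nat.exists_eq_succ_of_ne_zero hj0.ne'
        simp only [Nat.succ_eq_add_one, Nat.add_sub_cancel] at ht
        rcases (show j ≤ a.length by omega).eq_or_lt with rfl | hlt
        · rw [List.take_length] at ht
          have := signChanges_replicate_append s a.length []
          rw [List.append_nil, ← ht] at this
          simp [this, signChanges] at h
        · have ha : a = List.replicate j s ++ a[j] :: a.drop (j + 1) := by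
            rw [← ht, List.cons_getElem_drop_succ, List.take_append_drop]
          have h1 : signChanges s a
              = (if a[j] = s then 0 else 1) + signChanges a[j] (a.drop (j + 1)) := by
            conv_lhs => rw [ha, signChanges_replicate_append]
            rfl
          have h2 := signChanges_le a[j] s' (a.drop (j + 1))
          have h3 : a.length + 1 - (j + 1) = (a.drop (j + 1)).length + 1 := by
            rw [List.length_drop]; omega
          rw [h3, ih, mul_zero]
          simp only [maxChanges] at h
          generalize a[j] = l at *
          rcases l <;> rcases s <;> rcases s' <;> simp at * <;> omega
    · rfl

/-- An interval of `w_ε` together with the cluster of `t` it comes from: an interval of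
length `x` from a section has `len = some x`, an interval of length `ε` from a flange cluster
has `len = none`, and then `excess` is the multiplicity of the cluster minus one. -/
structure Item where
  sgn : Bool
  len : Option ℝ
  excess : ℕ

namespace Item

/-- Whether the item comes from a section. -/
def inSection (a : Item) : Bool := a.len.isSome

/-- The interval with the value `ε` substituted. -/
def interval (ε : ℝ) (a : Item) : Bool × ℝ := (a.sgn, a.len.getD ε)

/-- The separating letter between two adjacent intervals, if any. -/
def sep (a b : Item) : BW := if a.inSection ∧ b.inSection ∧ a.sgn = b.sgn then [!a.sgn] else []

/-- Adjacent items of equal sign belong to sections. -/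
def Compatible (a b : Item) : Prop := a.sgn = b.sgn → a.inSection ∧ b.inSection

end Item

/-- The letters following the block of the item `a`, where each further item carries a block of
size `e + 1`. -/
def tailWord : Item → List (Item × ℕ) → BW
  | _, [] => []
  | a, b :: r => a.sep b.1 ++ (List.replicate (b.2 + 1) b.1.sgn ++ tailWord b.1 r)

/-- The word in which the item paired with `e` carries a block of size `e + 1`. -/
def itemWord : List (Item × ℕ) → BW
  | [] => []
  | a :: r => List.replicate (a.2 + 1) a.1.sgn ++ tailWord a.1 r

/-- The contribution to `F_λ(w_ε)` of everything but the boxes inside the first block. -/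
noncomputable def tailWeight (ε : ℝ) : Item → List (Item × ℕ) → ℝ
  | a, [] => a.len.getD ε
  | a, b :: r =>
    (if a.sgn = b.1.sgn then a.len.getD ε * b.1.len.getD ε else a.len.getD ε + b.1.len.getD ε)
      * b.1.len.getD ε ^ b.2 * tailWeight ε b.1 r

lemma signChanges_tailWord (ε : ℝ) {a : Item} {r : List (Item × ℕ)}
    (h : (a :: r.map Prod.fst).IsChain Item.Compatible) :
    signChanges a.sgn (tailWord a r) = maxChanges a.sgn (r.map fun b => b.1.interval ε) := by
  induction r generalizing a with
  | nil => rfl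
  | cons b r ih =>
    simp only [List.map_cons, List.isChain_cons_cons] at h
    have := ih h.2
    obtain ⟨b, e⟩ := b
    simp only [tailWord, List.map_cons, Item.interval, maxChanges, Item.sep] at this ⊢
    by_cases hs : a.sgn = b.sgn
    · have h1 := h.1 hs
      rw [← this]
      simp [hs, h1, signChanges, List.replicate_succ, signChanges_replicate_append]
      omega
    · rw [← this]
      have hs' : ¬ b.sgn = a.sgn := fun h => hs h.symm
      simp [hs, hs', signChanges, List.replicate_succ, signChanges_replicate_append]

/-- A run of `s` followed by another letter cannot be covered beyond that letter. -/
lemma take_ne_replicate {s l : Bool} {p n : ℕ} {X : BW} (hl : l ≠ s) (hn : p < n) :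
    (List.replicate p s ++ l :: X).take n ≠ List.replicate n s := by
  intro h
  have h1 : ((List.replicate p s ++ l :: X).take n)[p]? = some l := by
    rw [List.getElem?_take_of_lt hn, List.getElem?_append_right (by simp)]; simp
  rw [h, List.getElem?_replicate, if_pos hn] at h1
  exact hl (Option.some.inj h1).symm

/-- The product formula for `F_λ(w_ε)` on zigzags with the maximal number of blocks. -/
lemma boxSum_itemWord (ε : ℝ) {a : Item} {r : List (Item × ℕ)} (p : ℕ)
    (h : (a :: r.map Prod.fst).IsChain Item.Compatible) :
    boxSum (a.interval ε :: r.map fun b => b.1.interval ε)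
        (List.replicate p a.sgn ++ tailWord a r)
        ((List.replicate p a.sgn ++ tailWord a r).length + 1)
      = a.len.getD ε ^ p * tailWeight ε a r := by
  induction r generalizing a p with
  | nil =>
    simp only [Item.interval, List.map_nil, tailWord, List.append_nil, tailWeight,
      List.length_replicate]
    rw [boxSum_cons, Finset.sum_eq_single (p + 1)]
    · simp [boxSum_nil, pow_succ]
    · intro j hj hj'
      rw [Finset.mem_range] at hj
      have h0 : p + 1 - j ≠ 0 := by omega
      simp [boxSum_nil, h0]
    · simp
  | cons b r ih =>
    obtain ⟨b, e⟩ := b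
    simp only [List.map_cons, List.isChain_cons_cons] at h
    have hch := signChanges_tailWord ε h.2
    simp only [List.map_cons]
    rw [Item.interval, boxSum_cons]
    by_cases hs : a.sgn = b.sgn
    · have hab := h.1 hs
      set X := List.replicate (e + 1) b.sgn ++ tailWord b r with hX
      have hw : tailWord a ((b, e) :: r) = (!a.sgn) :: X := by
        simp [tailWord, Item.sep, hs, hab, hX]
      rw [hw, Finset.sum_eq_single (p + 1)]
      · have hd : (List.replicate p a.sgn ++ (!a.sgn) :: X).drop (p + 1) = X := by
          rw [← List.drop_drop, List.drop_left' (by simp)]; rfl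
        have hl : (List.replicate p a.sgn ++ (!a.sgn) :: X).length + 1 - (p + 1)
            = X.length + 1 := by simp
        rw [if_pos (by rw [Nat.add_sub_cancel, List.take_left' (by simp)]), hd, hl, hX,
          ih (e + 1) h.2]
        simp only [tailWeight, if_pos hs]
        ring
      · intro j hj hjp
        rw [Finset.mem_range] at hj
        rcases lt_or_gt_of_ne hjp with hlt | hgt
        · have hd : (List.replicate p a.sgn ++ (!a.sgn) :: X).drop j
              = List.replicate (p - j) a.sgn ++ (!a.sgn) :: X := by
            rw [List.drop_append_of_le_length (by simp; omega), List.drop_replicate]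
          have hl : (List.replicate p a.sgn ++ (!a.sgn) :: X).length + 1 - j
            = ((List.replicate p a.sgn ++ (!a.sgn) :: X).drop j).length + 1 := by
            rw [List.length_drop, List.length_append, List.length_replicate]; omega
          rw [hl, hd, Item.interval, boxSum_eq_zero]
          · simp
          · rw [← hch, hs, signChanges_replicate_append, hX]
            simp [signChanges, List.replicate_succ, signChanges_replicate_append]
            omega
        · rw [if_neg]
          exact take_ne_replicate (by simp) (by omega)
      · simp
    · have hw : tailWord a ((b, e) :: r)
          = b.sgn :: (List.replicate e b.sgn ++ tailWord b r) := by
        simp [tailWord, Item.sep, hs, List.replicate_succ]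
      have hbs : b.sgn ≠ a.sgn := fun h => hs h.symm
      rw [hw]
      set X := List.replicate e b.sgn ++ tailWord b r with hX
      have hXs : b.sgn :: X = List.replicate (e + 1) b.sgn ++ tailWord b r := by
        simp [hX, List.replicate_succ]
      have hsub : ({p, p + 1} : Finset ℕ) ⊆
          Finset.range ((List.replicate p a.sgn ++ b.sgn :: X).length + 1 + 1) := by
        intro j hj
        simp only [Finset.mem_insert, Finset.mem_singleton] at hj
        simp; omega
      rw [← Finset.sum_subset hsub, Finset.sum_pair (by omega)]
      · have hd : (List.replicate p a.sgn ++ b.sgn :: X).drop (p + 1) = X := by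
          rw [← List.drop_drop, List.drop_left' (by simp)]; rfl
        have hl : (List.replicate p a.sgn ++ b.sgn :: X).length + 1 - (p + 1)
            = X.length + 1 := by simp
        have hd' : (List.replicate p a.sgn ++ b.sgn :: X).drop p = b.sgn :: X := by
          rw [List.drop_left' (by simp)]
        have hl' : (List.replicate p a.sgn ++ b.sgn :: X).length + 1 - p
            = (b.sgn :: X).length + 1 := by simp; omega
        have ht' : (List.replicate p a.sgn ++ b.sgn :: X).take (p - 1)
            = List.replicate (p - 1) a.sgn := by
          rw [List.take_append_of_le_length (by simp), List.take_replicate]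
          simp
        rw [if_pos ht', if_pos (by rw [Nat.add_sub_cancel, List.take_left' (by simp)]), hd, hl,
          hd', hl', hXs, ih (e + 1) h.2, hX, ih e h.2]
        simp only [tailWeight, if_neg hs]
        ring
      · intro j hj hjp
        rw [Finset.mem_range] at hj
        simp only [Finset.mem_insert, Finset.mem_singleton, not_or] at hjp
        rcases lt_or_gt_of_ne hjp.1 with hlt | hgt
        · have hd : (List.replicate p a.sgn ++ b.sgn :: X).drop j
              = List.replicate (p - j - 1 + 1) a.sgn ++ b.sgn :: X := by
            rw [List.drop_append_of_le_length (by simp; omega), List.drop_replicate]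
            congr 2; omega
          have hl : (List.replicate p a.sgn ++ b.sgn :: X).length + 1 - j
            = ((List.replicate p a.sgn ++ b.sgn :: X).drop j).length + 1 := by
            rw [List.length_drop, List.length_append, List.length_replicate]; omega
          rw [hl, hd, Item.interval, boxSum_eq_zero]
          · simp
          · rw [← hch, hXs]
            simp only [List.replicate_succ, List.cons_append, signChanges,
              signChanges_replicate_append, if_neg hs, if_neg hbs]
            omega
        · rw [if_neg]
          exact take_ne_replicate hbs (by omega)

lemma tendsto_pow_div_pow {m e : ℕ} (h : m ≤ e) :
    Filter.Tendsto (fun ε : ℝ => ε ^ e / ε ^ m) (nhdsWithin 0 (Set.Ioi 0))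
      (nhds (if e = m then 1 else 0)) := by
  have hev : (fun ε : ℝ => ε ^ (e - m)) =ᶠ[nhdsWithin 0 (Set.Ioi 0)] fun ε => ε ^ e / ε ^ m := by
    filter_upwards [self_mem_nhdsWithin] with ε hε
    have hε' : ε ≠ 0 := (Set.mem_Ioi.1 hε).ne'
    rw [eq_div_iff (pow_ne_zero _ hε'), ← pow_add, Nat.sub_add_cancel h]
  refine Filter.Tendsto.congr' hev ?_
  have hc : Filter.Tendsto (fun ε : ℝ => ε ^ (e - m)) (nhdsWithin 0 (Set.Ioi 0))
      (nhds ((0 : ℝ) ^ (e - m))) := by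
    have : Continuous fun ε : ℝ => ε ^ (e - m) := by fun_prop
    exact (this.tendsto 0).mono_left nhdsWithin_le_nhds
  convert hc using 2
  split_ifs with he
  · simp [he]
  · rw [zero_pow (by omega)]

namespace Item

/-- The order in `ε` of the factor of a corner between two adjacent items. -/
def cornerDegree (a b : Item) : ℕ := if a.inSection ∨ b.inSection then 0 else 1

/-- The leading coefficient of the factor of a corner between two adjacent items. -/
noncomputable def cornerLimit (a b : Item) : ℝ :=
  match a.len, b.len with
  | some x, some y => if a.sgn = b.sgn then x * y else x + y
  | some x, none => x
  | none, some y => y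
  | none, none => 2

/-- The order in `ε` of the `excess` many boxes of an item. -/
def innerDegree (a : Item) : ℕ := if a.inSection then 0 else a.excess

/-- The leading coefficient of `val ^ e`, normalised for `e = a.excess` on flange items. -/
noncomputable def innerLimit (a : Item) (e : ℕ) : ℝ :=
  match a.len with
  | some x => x ^ e
  | none => if e = a.excess then 1 else 0

/-- The order in `ε` of the length of the interval. -/
def lenDegree (a : Item) : ℕ := if a.inSection then 0 else 1

lemma tendsto_innerLimit {a : Item} {e : ℕ} (h : a.inSection = false → a.excess ≤ e) :
    Filter.Tendsto (fun ε : ℝ => a.len.getD ε ^ e / ε ^ a.innerDegree)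
      (nhdsWithin 0 (Set.Ioi 0)) (nhds (a.innerLimit e)) := by
  obtain ⟨s, _ | x, m⟩ := a
  · simpa [innerDegree, innerLimit, inSection] using tendsto_pow_div_pow (h rfl)
  · simp [innerDegree, innerLimit, inSection]

lemma tendsto_len (a : Item) :
    Filter.Tendsto (fun ε : ℝ => a.len.getD ε / ε ^ a.lenDegree)
      (nhdsWithin 0 (Set.Ioi 0)) (nhds (a.len.getD 1)) := by
  obtain ⟨s, _ | x, m⟩ := a
  · simpa [lenDegree, inSection] using tendsto_pow_div_pow (le_refl 1)
  · simp [lenDegree, inSection]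

lemma tendsto_cornerLimit {a b : Item} (h : a.Compatible b) :
    Filter.Tendsto (fun ε : ℝ =>
      (if a.sgn = b.sgn then a.len.getD ε * b.len.getD ε else a.len.getD ε + b.len.getD ε)
        / ε ^ a.cornerDegree b)
      (nhdsWithin 0 (Set.Ioi 0)) (nhds (a.cornerLimit b)) := by
  have hid : Filter.Tendsto (fun ε : ℝ => ε) (nhdsWithin 0 (Set.Ioi 0)) (nhds 0) :=
    Filter.tendsto_id.mono_left nhdsWithin_le_nhds
  obtain ⟨s, _ | x, m⟩ := a <;> obtain ⟨s', _ | y, m'⟩ := b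
  · have hs : s ≠ s' := by simpa [Compatible, inSection] using h
    have := (tendsto_pow_div_pow (le_refl 1)).const_mul 2
    simp only [cornerDegree, cornerLimit, inSection, hs]
    refine Filter.Tendsto.congr (fun ε => ?_) (by simpa using this)
    simp; ring
  · have hs : s ≠ s' := by simpa [Compatible, inSection] using h
    simpa [cornerDegree, cornerLimit, inSection, hs] using hid.add_const y
  · have hs : s ≠ s' := by simpa [Compatible, inSection] using h
    simpa [cornerDegree, cornerLimit, inSection, hs] using hid.const_add x
  · simp [cornerDegree, cornerLimit, inSection]

end Item

/-- The order in `ε` of `tailWeight`. -/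
def tailDegree : Item → List Item → ℕ
  | a, [] => a.lenDegree
  | a, b :: r => a.cornerDegree b + b.innerDegree + tailDegree b r

/-- The leading coefficient of `tailWeight`. -/
noncomputable def tailLimit : Item → List (Item × ℕ) → ℝ
  | a, [] => a.len.getD 1
  | a, b :: r => a.cornerLimit b.1 * b.1.innerLimit b.2 * tailLimit b.1 r

/-- The order in `ε` of `F_λ(w_ε)`. -/
def itemDegree : List Item → ℕ
  | [] => 0
  | a :: r => a.lenDegree + a.innerDegree + tailDegree a r

/-- The leading coefficient of `F_λ(w_ε)`. -/
noncomputable def itemLimit : List (Item × ℕ) → ℝ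
  | [] => 1
  | a :: r => a.1.len.getD 1 * a.1.innerLimit a.2 * tailLimit a.1 r

lemma tendsto_tailWeight {a : Item} {r : List (Item × ℕ)}
    (hc : (a :: r.map Prod.fst).IsChain Item.Compatible)
    (hr : ∀ b ∈ r, b.1.inSection = false → b.1.excess ≤ b.2) :
    Filter.Tendsto (fun ε : ℝ => tailWeight ε a r / ε ^ tailDegree a (r.map Prod.fst))
      (nhdsWithin 0 (Set.Ioi 0)) (nhds (tailLimit a r)) := by
  induction r generalizing a with
  | nil => exact a.tendsto_len
  | cons b r ih =>
    simp only [List.map_cons, List.isChain_cons_cons] at hc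
    have h1 := Item.tendsto_cornerLimit hc.1
    have h2 := Item.tendsto_innerLimit (hr b (by simp))
    have h3 := ih hc.2 fun b hb => hr b (by simp [hb])
    refine Filter.Tendsto.congr (fun ε => ?_) ((h1.mul h2).mul h3)
    simp only [tailWeight, tailDegree, List.map_cons, pow_add]
    rw [div_mul_div_comm, div_mul_div_comm]

lemma Fword_itemWord (ε : ℝ) {a : Item × ℕ} {r : List (Item × ℕ)}
    (h : ((a :: r).map Prod.fst).IsChain Item.Compatible) :
    Fword ((a :: r).map fun b => b.1.interval ε) (itemWord (a :: r))
      = a.1.len.getD ε ^ (a.2 + 1) * tailWeight ε a.1 r :=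
  boxSum_itemWord ε (a.2 + 1) h

lemma tendsto_Fword {L : List (Item × ℕ)} (hL : L ≠ [])
    (hc : (L.map Prod.fst).IsChain Item.Compatible)
    (hr : ∀ b ∈ L, b.1.inSection = false → b.1.excess ≤ b.2) :
    Filter.Tendsto (fun ε : ℝ =>
        Fword (L.map fun b => b.1.interval ε) (itemWord L) / ε ^ itemDegree (L.map Prod.fst))
      (nhdsWithin 0 (Set.Ioi 0)) (nhds (itemLimit L)) := by
  cases L with
  | nil => exact absurd rfl hL
  | cons a r =>
    have h1 := a.1.tendsto_len
    have h2 := Item.tendsto_innerLimit (hr a (by simp))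
    have h3 := tendsto_tailWeight (by simpa using hc) fun b hb => hr b (by simp [hb])
    refine Filter.Tendsto.congr (fun ε => ?_) ((h1.mul h2).mul h3)
    rw [Fword_itemWord ε hc]
    simp only [itemDegree, List.map_cons, pow_add]
    rw [div_mul_div_comm, div_mul_div_comm]
    ring

lemma tailLimit_section {a : Item} {r : List (Item × ℕ)} (ε : ℝ) (ha : a.inSection)
    (hr : ∀ b ∈ r, b.1.inSection) : tailLimit a r = tailWeight ε a r := by
  induction r generalizing a with
  | nil =>
    obtain ⟨s, _ | x, m⟩ := a
    · simp [Item.inSection] at ha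
    · rfl
  | cons b r ih =>
    have hb := hr b (by simp)
    have := ih hb fun b hb => hr b (by simp [hb])
    obtain ⟨⟨s', _ | y, m'⟩, e⟩ := b
    · simp [Item.inSection] at hb
    obtain ⟨s, _ | x, m⟩ := a
    · simp [Item.inSection] at ha
    simp only [tailLimit, tailWeight, this]
    rfl

lemma itemLimit_section {L : List (Item × ℕ)} (hL : L ≠ []) (ε : ℝ)
    (h : ∀ b ∈ L, b.1.inSection) :
    itemLimit L = Fword (L.map fun b => b.1.interval ε) (itemWord L) := by
  cases L with
  | nil => exact absurd rfl hL
  | cons a r =>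
    have hc : ((a :: r).map Prod.fst).IsChain Item.Compatible := by
      rw [List.isChain_map]
      refine List.Pairwise.isChain (List.pairwise_iff_forall_sublist.2 fun {x y} hxy _ => ?_)
      exact ⟨h x (hxy.subset (by simp)), h y (hxy.subset (by simp))⟩
    rw [Fword_itemWord ε hc, itemLimit,
      tailLimit_section ε (h a (by simp)) fun b hb => h b (by simp [hb])]
    have ha := h a (by simp)
    obtain ⟨⟨s, _ | x, m⟩, e⟩ := a
    · simp [Item.inSection] at ha
    simp only [Item.innerLimit, Option.getD_some, pow_succ]
    ring

/-- The normalisation constant of a group of flange items. -/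
noncomputable def flangeConst {α : Type*} (A : List α) : ℝ := 2 ^ (A.length - 1)

open Classical in
lemma tailLimit_flange {a : Item} {r : List (Item × ℕ)} (ha : a.inSection = false)
    (hr : ∀ b ∈ r, b.1.inSection = false) :
    tailLimit a r = 2 ^ r.length * if ∀ b ∈ r, b.2 = b.1.excess then 1 else 0 := by
  induction r generalizing a with
  | nil =>
    obtain ⟨s, _ | x, m⟩ := a
    · simp [tailLimit]
    · simp [Item.inSection] at ha
  | cons b r ih =>
    have hb := hr b (by simp)
    have := ih hb fun b hb => hr b (by simp [hb])
    obtain ⟨⟨s', _ | y, m'⟩, e⟩ := b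
    swap; · simp [Item.inSection] at hb
    obtain ⟨s, _ | x, m⟩ := a
    swap; · simp [Item.inSection] at ha
    simp only [tailLimit, this, Item.cornerLimit, Item.innerLimit, List.forall_mem_cons,
      List.length_cons, pow_succ]
    by_cases h1 : e = m' <;> simp [h1]
    ring_nf

open Classical in
lemma itemLimit_flange {L : List (Item × ℕ)} (h : ∀ b ∈ L, b.1.inSection = false) :
    itemLimit L = flangeConst L * if ∀ b ∈ L, b.2 = b.1.excess then 1 else 0 := by
  cases L with
  | nil => simp [itemLimit, flangeConst]
  | cons a r =>
    rw [itemLimit, tailLimit_flange (h a (by simp)) fun b hb => h b (by simp [hb])]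
    have ha := h a (by simp)
    obtain ⟨⟨s, _ | x, m⟩, e⟩ := a
    swap; · simp [Item.inSection] at ha
    simp only [Item.innerLimit, List.forall_mem_cons, flangeConst, List.length_cons,
      Nat.add_sub_cancel, Option.getD_none]
    by_cases h1 : e = m <;> simp [h1]

/-- `X` does not end with an item of the kind (section or flange) with which `Y` starts. -/
def KindBreak {α : Type*} (kind : α → Bool) (X Y : List α) : Prop :=
  ∀ x ∈ X.getLast?, ∀ y ∈ Y.head?, kind x ≠ kind y

lemma KindBreak.of_cons_cons {α : Type*} {kind : α → Bool} {a b : α} {X Y : List α}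
    (h : KindBreak kind (a :: b :: X) Y) : KindBreak kind (b :: X) Y := by
  simpa [KindBreak, List.getLast?_cons_cons] using h

lemma tailLimit_append {a : Item × ℕ} {X Y : List (Item × ℕ)}
    (h : KindBreak (fun b => b.1.inSection) (a :: X) Y) :
    tailLimit a.1 (X ++ Y) = tailLimit a.1 X * itemLimit Y := by
  induction X generalizing a with
  | nil =>
    cases Y with
    | nil => simp [itemLimit]
    | cons b Y =>
      have hk : a.1.inSection ≠ b.1.inSection := by simpa [KindBreak] using h
      simp only [List.nil_append, tailLimit, itemLimit]
      obtain ⟨⟨s, _ | x, m⟩, e⟩ := a <;> obtain ⟨⟨s', _ | y, m'⟩, e'⟩ := b <;>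
        simp [Item.inSection, Item.cornerLimit, mul_assoc] at hk ⊢
  | cons b X ih =>
    simp only [List.cons_append, tailLimit, ih h.of_cons_cons]
    ring

lemma itemLimit_append {X Y : List (Item × ℕ)}
    (h : KindBreak (fun b => b.1.inSection) X Y) :
    itemLimit (X ++ Y) = itemLimit X * itemLimit Y := by
  cases X with
  | nil => simp [itemLimit]
  | cons a X =>
    simp only [List.cons_append, itemLimit, tailLimit_append h]
    ring

lemma Item.sep_eq_nil {a b : Item} (h : a.inSection ≠ b.inSection) : a.sep b = [] := by
  rw [Item.sep, if_neg]
  rintro ⟨h1, h2, -⟩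
  exact h (h1.trans h2.symm)

lemma tailWord_append {a : Item × ℕ} {X Y : List (Item × ℕ)}
    (h : KindBreak (fun b => b.1.inSection) (a :: X) Y) :
    tailWord a.1 (X ++ Y) = tailWord a.1 X ++ itemWord Y := by
  induction X generalizing a with
  | nil =>
    cases Y with
    | nil => simp [tailWord, itemWord]
    | cons b Y =>
      have hk : a.1.inSection ≠ b.1.inSection := by simpa [KindBreak] using h
      simp [tailWord, itemWord, Item.sep_eq_nil hk]
  | cons b X ih =>
    simp [tailWord, ih h.of_cons_cons]

lemma itemWord_append {X Y : List (Item × ℕ)}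
    (h : KindBreak (fun b => b.1.inSection) X Y) :
    itemWord (X ++ Y) = itemWord X ++ itemWord Y := by
  cases X with
  | nil => simp [itemWord]
  | cons a X => simp [itemWord, tailWord_append h]

/-- The template of a list of items. -/
def itemClusters : List Item → List (Bool × ℕ∞)
  | [] => []
  | [a] => [(a.sgn, ⊤)]
  | a :: b :: r => (a.sgn, ⊤) :: ((a.sep b).map fun s => (s, 1)) ++ itemClusters (b :: r)

lemma itemClusters_append {X Y : List Item} (h : KindBreak Item.inSection X Y) :
    itemClusters (X ++ Y) = itemClusters X ++ itemClusters Y := by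
  induction X with
  | nil => simp [itemClusters]
  | cons a X ih =>
    cases X with
    | nil =>
      cases Y with
      | nil => simp [itemClusters]
      | cons b Y =>
        have hk : a.inSection ≠ b.inSection := by simpa [KindBreak] using h
        simp [itemClusters, Item.sep_eq_nil hk]
    | cons b X =>
      have := ih h.of_cons_cons
      simp only [List.cons_append] at this ⊢
      simp [itemClusters, this]

/-- Multiplicativity at changes of kind turns into a product over the whole splitting. -/
lemma map_splitting_aux {α M : Type*} [Monoid M] {kind : α → Bool} {f : List α → M}
    (h1 : f [] = 1) (hf : ∀ X Y, KindBreak kind X Y → f (X ++ Y) = f X * f Y) {k : ℕ}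
    (A T : Fin k → List α) (hA : ∀ j, ∀ x ∈ A j, kind x = false)
    (hT : ∀ i, ∀ x ∈ T i, kind x = true) (hTne : ∀ i, T i ≠ [])
    (hAne : ∀ i : Fin k, (i : ℕ) + 1 ≠ k → A i ≠ []) :
    f (List.ofFn fun i => T i ++ A i).flatten = (List.ofFn fun i => f (T i) * f (A i)).prod := by
  induction k with
  | zero => simpa using h1
  | succ k ih =>
    simp only [List.ofFn_succ, List.flatten_cons, List.prod_cons]
    have hrec := ih (fun i => A i.succ) (fun i => T i.succ) (fun i => hA _) (fun i => hT _)
      (fun i => hTne _) fun i hi => hAne _ (by simpa using hi)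
    have hb2 : KindBreak kind (A 0) (List.ofFn fun i : Fin k => T i.succ ++ A i.succ).flatten := by
      intro x hx y hy
      rw [hA 0 x (List.mem_of_getLast? hx)]
      cases k with
      | zero => simp at hy
      | succ k =>
        rw [List.ofFn_succ, List.flatten_cons, List.append_assoc,
          List.head?_append_of_ne_nil _ (hTne _)] at hy
        rw [hT _ y (List.mem_of_head? hy)]
        simp
    have hb1 : KindBreak kind (T 0)
        (A 0 ++ (List.ofFn fun i : Fin k => T i.succ ++ A i.succ).flatten) := by
      intro x hx y hy
      rw [hT 0 x (List.mem_of_getLast? hx)]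
      by_cases hA0 : A 0 = []
      · have hk : k = 0 := by
          by_contra hk
          exact hAne 0 (by simpa using hk) hA0
        subst hk
        simp [hA0] at hy
      · rw [List.head?_append_of_ne_nil _ hA0] at hy
        rw [hA _ y (List.mem_of_head? hy)]
        simp
    rw [List.append_assoc, hf _ _ hb1, hf _ _ hb2, hrec, mul_assoc]

lemma map_splitting {α M : Type*} [Monoid M] {kind : α → Bool} {f : List α → M}
    (h1 : f [] = 1) (hf : ∀ X Y, KindBreak kind X Y → f (X ++ Y) = f X * f Y) {k : ℕ}
    (A : Fin (k + 1) → List α) (T : Fin k → List α) (hA : ∀ j, ∀ x ∈ A j, kind x = false)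
    (hT : ∀ i, ∀ x ∈ T i, kind x = true) (hTne : ∀ i, T i ≠ [])
    (hAne : ∀ j : Fin (k + 1), (j : ℕ) ≠ 0 → (j : ℕ) ≠ k → A j ≠ []) :
    f (A 0 ++ (List.ofFn fun i => T i ++ A i.succ).flatten)
      = f (A 0) * (List.ofFn fun i => f (T i) * f (A i.succ)).prod := by
  have hb : KindBreak kind (A 0) (List.ofFn fun i : Fin k => T i ++ A i.succ).flatten := by
    intro x hx y hy
    rw [hA 0 x (List.mem_of_getLast? hx)]
    cases k with
    | zero => simp at hy
    | succ k =>
      rw [List.ofFn_succ, List.flatten_cons, List.append_assoc,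
        List.head?_append_of_ne_nil _ (hTne _)] at hy
      rw [hT _ y (List.mem_of_head? hy)]
      simp
  rw [hf _ _ hb, map_splitting_aux h1 hf (fun i => A i.succ) T (fun i => hA _) hT hTne
    fun i hi => hAne _ (by simp) (by simpa using hi)]

lemma flatten_splitting {α β : Type*} {kind : α → Bool} {f : List α → List β}
    (h1 : f [] = []) (hf : ∀ X Y, KindBreak kind X Y → f (X ++ Y) = f X ++ f Y) {k : ℕ}
    (A : Fin (k + 1) → List α) (T : Fin k → List α) (hA : ∀ j, ∀ x ∈ A j, kind x = false)
    (hT : ∀ i, ∀ x ∈ T i, kind x = true) (hTne : ∀ i, T i ≠ [])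
    (hAne : ∀ j : Fin (k + 1), (j : ℕ) ≠ 0 → (j : ℕ) ≠ k → A j ≠ []) :
    f (A 0 ++ (List.ofFn fun i => T i ++ A i.succ).flatten)
      = f (A 0) ++ (List.ofFn fun i => f (T i) ++ f (A i.succ)).flatten := by
  have := map_splitting (M := FreeMonoid β) (f := fun X => FreeMonoid.ofList (f X))
    (by simp [h1]) (fun X Y h => by simp [hf X Y h]) A T hA hT hTne hAne
  have := congrArg FreeMonoid.toList this
  rw [FreeMonoid.toList_mul, FreeMonoid.toList_prod, List.map_ofFn] at this
  exact this

lemma exists_cons_of_map_fst_eq {s : Bool} {cs : List (Bool × ℕ∞)} {v : List (Bool × ℝ)}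
    (h : v.map Prod.fst = infSigns ((s, ⊤) :: cs)) :
    ∃ x v', v = (s, x) :: v' ∧ v'.map Prod.fst = infSigns cs := by
  match v with
  | [] => simp [infSigns] at h
  | (s', x) :: v' =>
    have h' : s' = s ∧ v'.map Prod.fst = infSigns cs := by simpa [infSigns] using h
    exact ⟨x, v', by rw [h'.1], h'.2⟩

/-- Every finite cluster of the list is a separating one. -/
def AllSeparating (cs : List (Bool × ℕ∞)) : Prop :=
  ∀ i < cs.length, (cs.getD i (true, 1)).2 ≠ ⊤ → 0 < i ∧ i + 1 < cs.length ∧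
    (cs.getD i (true, 1)).2 = 1 ∧ (cs.getD (i - 1) (true, 1)).2 = ⊤ ∧
    (cs.getD (i + 1) (true, 1)).2 = ⊤

lemma AllSeparating.of_cons {c d : Bool × ℕ∞} {cs : List (Bool × ℕ∞)}
    (h : AllSeparating (c :: d :: cs)) (hd : d.2 = ⊤) : AllSeparating (d :: cs) := by
  intro i hi hfin
  obtain ⟨-, h2, h3, h4, h5⟩ := h (i + 1) (by simpa using hi) (by simpa using hfin)
  have hi0 : i ≠ 0 := by
    rintro rfl
    simp [hd] at hfin
  obtain ⟨i, rfl⟩ := Nat.exists_eq_succ_of_ne_zero hi0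
  exact ⟨i.succ_pos, by simpa using h2, by simpa using h3, by simpa using h4, by simpa using h5⟩

lemma AllSeparating.of_cons_cons {c d e : Bool × ℕ∞} {cs : List (Bool × ℕ∞)}
    (h : AllSeparating (c :: d :: e :: cs)) (he : e.2 = ⊤) : AllSeparating (e :: cs) := by
  intro i hi hfin
  obtain ⟨-, h2, h3, h4, h5⟩ := h (i + 2) (by simpa using hi) (by simpa using hfin)
  have hi0 : i ≠ 0 := by
    rintro rfl
    simp [he] at hfin
  obtain ⟨i, rfl⟩ := Nat.exists_eq_succ_of_ne_zero hi0
  exact ⟨i.succ_pos, by simp at h2 ⊢; omega, by simpa using h3, by simpa using h4,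
    by simpa using h5⟩

lemma tuClusters_eq_of_allSeparating {cs : List (Bool × ℕ∞)}
    (halt : cs.IsChain fun c d => c.1 ≠ d.1) (hfin : AllSeparating cs)
    {v : List (Bool × ℝ)} (hv : v.map Prod.fst = infSigns cs) : tuClusters v = cs := by
  induction hn : cs.length using Nat.strong_induction_on generalizing cs v with | _ n ih
  match cs with
  | [] =>
    obtain rfl : v = [] := by simpa [infSigns] using hv
    rfl
  | (s, m) :: rest =>
    obtain rfl : m = ⊤ := by
      by_contra hm
      exact absurd (hfin 0 (by simp) (by simpa using hm)).1 (by simp)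
    obtain ⟨x, v, rfl, hv1⟩ := exists_cons_of_map_fst_eq hv
    match rest with
    | [] =>
      obtain rfl : v = [] := by simpa [infSigns] using hv1
      rfl
    | (s', m') :: rest =>
      obtain ⟨hss, halt1⟩ := List.isChain_cons_cons.1 halt
      by_cases hm' : m' = ⊤
      · subst hm'
        have key := ih _ (by simp [← hn]) halt1 (hfin.of_cons rfl) hv1 rfl
        obtain ⟨y, v, rfl, -⟩ := exists_cons_of_map_fst_eq hv1
        rw [tuClusters, if_neg hss, key]
      · obtain ⟨-, h2, h3, -, h5⟩ := hfin 1 (by simp) (by simpa using hm')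
        obtain rfl : m' = 1 := by simpa using h3
        match rest with
        | [] => simp at h2
        | (s'', m'') :: rest =>
          obtain rfl : m'' = ⊤ := by simpa using h5
          obtain ⟨hss', halt2⟩ := List.isChain_cons_cons.1 halt1
          have hv2 : v.map Prod.fst = infSigns ((s'', ⊤) :: rest) := by
            simpa [infSigns] using hv1
          have key := ih _ (by simp [← hn]) halt2 (hfin.of_cons_cons rfl) hv2 rfl
          obtain ⟨y, v, rfl, -⟩ := exists_cons_of_map_fst_eq hv2
          have hs' : s' = !s := Bool.eq_not.2 (Ne.symm hss)
          have hs'' : s = s'' := by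
            rw [hs'] at hss'
            simpa using hss'
          rw [tuClusters, if_pos hs'', key, hs']

lemma infSigns_append (cs cs' : List (Bool × ℕ∞)) :
    infSigns (cs ++ cs') = infSigns cs ++ infSigns cs' := by
  simp [infSigns]

lemma infSigns_eq_nil {cs : List (Bool × ℕ∞)} (h : ∀ c ∈ cs, c.2 ≠ ⊤) : infSigns cs = [] := by
  simpa [infSigns] using h

lemma length_infSigns_flatten_ofFn {k : ℕ} (cs : Fin k → List (Bool × ℕ∞)) :
    (infSigns (List.ofFn cs).flatten).length = ∑ i, (infSigns (cs i)).length := by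
  induction k with
  | zero => simp [infSigns]
  | succ k ih =>
    rw [List.ofFn_succ, List.flatten_cons, infSigns_append, List.length_append, ih,
      Fin.sum_univ_succ]

section

variable {t : Template}

lemma SectionData.numInf_eq (D : SectionData t) :
    t.numInf = ∑ i, (infSigns (D.T i).clusters).length := by
  have h : t.numInf = (infSigns t.clusters).length := by simp [Template.numInf, infSigns]
  rw [h, D.concat, infSigns_append, infSigns_eq_nil (D.finA 0), List.nil_append,
    length_infSigns_flatten_ofFn]
  refine Finset.sum_congr rfl fun i _ => ?_
  rw [infSigns_append, infSigns_eq_nil (D.finA i.succ), List.append_nil]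

lemma map_fst_vD (D : SectionData t) {w : List ℝ} (hlen : w.length = t.numInf) (i : Fin D.k) :
    (vD D w i).map Prod.fst = infSigns (D.T i).clusters := by
  rw [vD, List.map_fst_zip]
  rw [List.length_drop, hlen, D.numInf_eq]
  have h : secOffset D i + (infSigns (D.T i).clusters).length
      ≤ ∑ i, (infSigns (D.T i).clusters).length := by
    have hi : i ∉ Finset.univ.filter (· < i) := by simp
    rw [secOffset, add_comm,
      ← Finset.sum_insert (f := fun i => (infSigns (D.T i).clusters).length) hi]
    exact Finset.sum_le_sum_of_subset (Finset.subset_univ _)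
  omega

lemma tuClusters_vD (D : SectionData t) {w : List ℝ} (hlen : w.length = t.numInf) (i : Fin D.k) :
    tuClusters (vD D w i) = (D.T i).clusters :=
  tuClusters_eq_of_allSeparating (D.T i).alternating (D.secFin i) (map_fst_vD D hlen i)

lemma vD_ne_nil (D : SectionData t) {w : List ℝ} (hlen : w.length = t.numInf) (i : Fin D.k) :
    vD D w i ≠ [] := by
  intro h
  have := tuClusters_vD D hlen i
  rw [h] at this
  exact (D.T i).ne this.symm

/-- The items of the `i`-th section. -/
noncomputable def sectionItems (D : SectionData t) (w : List ℝ) (i : Fin D.k) : List Item :=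
  (vD D w i).map fun p => ⟨p.1, some p.2, 0⟩

/-- The items of the `j`-th flange word. -/
def flangeItems (D : SectionData t) (j : Fin (D.k + 1)) : List Item :=
  (D.A j).map fun c => ⟨c.1, none, c.2.toNat - 1⟩

/-- All items of `w_ε`. -/
noncomputable def items (D : SectionData t) (w : List ℝ) : List Item :=
  flangeItems D 0 ++ (List.ofFn fun i => sectionItems D w i ++ flangeItems D i.succ).flatten

lemma map_interval_sectionItems (D : SectionData t) (w : List ℝ) (ε : ℝ) (i : Fin D.k) :
    (sectionItems D w i).map (Item.interval ε) = vD D w i := by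
  rw [sectionItems, List.map_map]
  exact List.map_id _

lemma map_interval_items (D : SectionData t) (w : List ℝ) (ε : ℝ) :
    (items D w).map (Item.interval ε) = weps D w ε := by
  have hA (j) : (flangeItems D j).map (Item.interval ε) = (D.A j).map fun c => (c.1, ε) := by
    rw [flangeItems, List.map_map]; rfl
  simp only [items, weps, List.map_append, map_flatten_ofFn, hA, map_interval_sectionItems]

lemma inSection_of_mem_sectionItems (D : SectionData t) (w : List ℝ) (i : Fin D.k) :
    ∀ a ∈ sectionItems D w i, a.inSection = true := by
  simp only [sectionItems, List.mem_map]
  rintro _ ⟨p, -, rfl⟩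
  rfl

lemma inSection_of_mem_flangeItems (D : SectionData t) (j : Fin (D.k + 1)) :
    ∀ a ∈ flangeItems D j, a.inSection = false := by
  simp only [flangeItems, List.mem_map]
  rintro _ ⟨p, -, rfl⟩
  rfl

/-- The template of the items is that of the intervals. -/
lemma tuClusters_map_interval {J : List Item} (h : J.IsChain Item.Compatible) (ε : ℝ) :
    tuClusters (J.map (Item.interval ε)) = itemClusters J := by
  induction J with
  | nil => rfl
  | cons a J ih =>
    cases J with
    | nil => rfl
    | cons b J =>
      have hab := (List.isChain_cons_cons.1 h).1
      have := ih (List.isChain_cons_cons.1 h).2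
      simp only [List.map_cons, Item.interval, tuClusters, itemClusters, Item.sep] at this ⊢
      rw [this]
      by_cases hs : a.sgn = b.sgn
      · have := hab hs
        simp [this, hs]
      · simp [hs]

lemma isChain_compatible_of_inSection {J : List Item} (h : ∀ a ∈ J, a.inSection = true) :
    J.IsChain Item.Compatible :=
  List.Pairwise.isChain <| List.pairwise_iff_forall_sublist.2 fun {x y} hxy _ =>
    ⟨h x (hxy.subset (by simp)), h y (hxy.subset (by simp))⟩

lemma isChain_compatible_of_itemClusters {J : List Item}
    (h : (itemClusters J).IsChain fun c d => c.1 ≠ d.1) : J.IsChain Item.Compatible := by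
  induction J with
  | nil => simp
  | cons a J ih =>
    cases J with
    | nil => simp
    | cons b J =>
      rw [itemClusters] at h
      refine List.isChain_cons_cons.2 ⟨fun hs => ?_, ih (h.suffix (List.suffix_append _ _))⟩
      by_contra hk
      obtain ⟨m, Y, hY⟩ : ∃ m Y, itemClusters (b :: J) = (b.sgn, m) :: Y := by
        cases J <;> simp [itemClusters]
      rw [Item.sep, if_neg (fun h => hk ⟨h.1, h.2.1⟩), hY] at h
      simp [hs] at h

lemma itemClusters_sectionItems (D : SectionData t) {w : List ℝ} (hlen : w.length = t.numInf)
    (i : Fin D.k) : itemClusters (sectionItems D w i) = (D.T i).clusters := by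
  rw [← tuClusters_vD D hlen i, ← map_interval_sectionItems D w 0 i, tuClusters_map_interval]
  exact isChain_compatible_of_inSection (inSection_of_mem_sectionItems D w i)

/-- The clusters with all multiplicities made infinite. -/
def inflate (cs : List (Bool × ℕ∞)) : List (Bool × ℕ∞) := cs.map fun c => (c.1, ⊤)

lemma itemClusters_of_flange {J : List Item} (h : ∀ a ∈ J, a.inSection = false) :
    itemClusters J = J.map fun a => (a.sgn, ⊤) := by
  induction J with
  | nil => rfl
  | cons a J ih =>
    cases J with
    | nil => rfl
    | cons b J =>
      rw [itemClusters, ih fun a ha => h a (by simp [ha])]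
      simp [Item.sep, h a (by simp)]

lemma itemClusters_flangeItems (D : SectionData t) (j : Fin (D.k + 1)) :
    itemClusters (flangeItems D j) = inflate (D.A j) := by
  rw [itemClusters_of_flange (inSection_of_mem_flangeItems D j), flangeItems, List.map_map]
  rfl

lemma sectionItems_ne_nil (D : SectionData t) {w : List ℝ} (hlen : w.length = t.numInf)
    (i : Fin D.k) : sectionItems D w i ≠ [] := by
  simpa [sectionItems] using vD_ne_nil D hlen i

lemma itemClusters_items (D : SectionData t) {w : List ℝ} (hlen : w.length = t.numInf) :
    itemClusters (items D w) = inflate (D.A 0) ++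
      (List.ofFn fun i => (D.T i).clusters ++ inflate (D.A i.succ)).flatten := by
  rw [items, flatten_splitting rfl (fun _ _ => itemClusters_append)
    (flangeItems D) (sectionItems D w) (inSection_of_mem_flangeItems D)
    (inSection_of_mem_sectionItems D w) (sectionItems_ne_nil D hlen)
    fun j h0 hk => by simpa [flangeItems] using D.interior_ne j h0 hk]
  simp only [itemClusters_flangeItems, itemClusters_sectionItems D hlen]

lemma map_fst_inflate (cs : List (Bool × ℕ∞)) :
    (inflate cs).map Prod.fst = cs.map Prod.fst := by
  simp [inflate]

lemma map_fst_itemClusters_items (D : SectionData t) {w : List ℝ} (hlen : w.length = t.numInf) :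
    (itemClusters (items D w)).map Prod.fst = t.clusters.map Prod.fst := by
  rw [itemClusters_items D hlen, D.concat]
  simp only [List.map_append, map_flatten_ofFn, map_fst_inflate]

lemma isChain_map_fst (t : Template) : (t.clusters.map Prod.fst).IsChain (· ≠ ·) :=
  (List.isChain_map _).2 t.alternating

lemma isChain_items (D : SectionData t) {w : List ℝ} (hlen : w.length = t.numInf) :
    (items D w).IsChain Item.Compatible := by
  refine isChain_compatible_of_itemClusters ?_
  have h := isChain_map_fst t
  rw [← map_fst_itemClusters_items D hlen] at h
  exact (List.isChain_map _).1 h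

/-- The blocks of `clWord cs N`. -/
def instantiate (cs : List (Bool × ℕ∞)) (N : ℕ) : List (Bool × ℕ) :=
  cs.map fun c => (c.1, if c.2 = ⊤ then N else c.2.toNat)

lemma clWord_eq_blockWord (cs : List (Bool × ℕ∞)) (N : ℕ) :
    clWord cs N = blockWord (instantiate cs N) := by
  rw [clWord, blockWord, instantiate, List.map_map]
  rfl

lemma instantiate_append (cs cs' : List (Bool × ℕ∞)) (N : ℕ) :
    instantiate (cs ++ cs') N = instantiate cs N ++ instantiate cs' N :=
  List.map_append

lemma instantiate_flatten_ofFn {k : ℕ} (cs : Fin k → List (Bool × ℕ∞)) (N : ℕ) :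
    instantiate (List.ofFn cs).flatten N = (List.ofFn fun i => instantiate (cs i) N).flatten :=
  map_flatten_ofFn _ _

lemma map_fst_instantiate (cs : List (Bool × ℕ∞)) (N : ℕ) :
    (instantiate cs N).map Prod.fst = cs.map Prod.fst := by
  rw [instantiate, List.map_map]
  rfl

lemma clWord_append (cs cs' : List (Bool × ℕ∞)) (N : ℕ) :
    clWord (cs ++ cs') N = clWord cs N ++ clWord cs' N := by
  simp only [clWord_eq_blockWord, instantiate_append, blockWord_append]

lemma clWord_flatten_ofFn {k : ℕ} (cs : Fin k → List (Bool × ℕ∞)) (N : ℕ) :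
    clWord (List.ofFn cs).flatten N = (List.ofFn fun i => clWord (cs i) N).flatten := by
  simp only [clWord_eq_blockWord, instantiate_flatten_ofFn, blockWord_flatten_ofFn]

lemma clWord_mono (cs : List (Bool × ℕ∞)) {N N' : ℕ} (h : N ≤ N') :
    (clWord cs N).Sublist (clWord cs N') := by
  rw [clWord_eq_blockWord, clWord_eq_blockWord]
  refine blockWord_sublist_of_forall₂ ?_
  rw [instantiate, instantiate, List.forall₂_map_left_iff, List.forall₂_map_right_iff,
    List.forall₂_same]
  intro c _
  refine ⟨rfl, ?_⟩
  dsimp only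
  split_ifs
  · exact h
  · exact le_rfl

lemma fitsSigns_of_mem_Zcl {cs : List (Bool × ℕ∞)} {y : BW} (h : y ∈ Zcl cs) :
    FitsSigns (cs.map Prod.fst) y := by
  obtain ⟨N, h⟩ := h
  rw [clWord_eq_blockWord] at h
  rw [← map_fst_instantiate cs N]
  exact FitsSigns.of_sublist h

lemma flangeWord_eq_clWord {cs : List (Bool × ℕ∞)} (h : ∀ c ∈ cs, c.2 ≠ ⊤) (N : ℕ) :
    flangeWord cs = clWord cs N := by
  rw [flangeWord, clWord]
  congr 1
  refine List.map_congr_left fun c hc => ?_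
  rw [if_neg (h c hc)]

lemma flangeWord_mem_Zcl {cs : List (Bool × ℕ∞)} (h : ∀ c ∈ cs, c.2 ≠ ⊤) :
    flangeWord cs ∈ Zcl cs :=
  ⟨0, by rw [flangeWord_eq_clWord h 0]⟩

lemma instantiate_pos {cs : List (Bool × ℕ∞)} (h : ∀ c ∈ cs, c.2 ≠ 0) :
    ∀ c ∈ instantiate cs 1, 0 < c.2 := by
  simp only [instantiate, List.mem_map]
  rintro _ ⟨c, hc, rfl⟩
  dsimp only
  split_ifs with ht
  · exact one_pos
  · exact Nat.pos_of_ne_zero fun h0 => (ENat.toNat_eq_zero.1 h0).elim (h c hc) ht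

lemma not_mem_Jt {μ : BW} (h : (clWord t.clusters 1).Sublist μ) : μ ∉ Jt t := by
  rintro ⟨p, ⟨hp, hfin, -⟩, N, hN⟩
  have h := h.trans hN
  rw [clWord_eq_blockWord, clWord_eq_blockWord] at h
  have hgetD : t.clusters.getD p (true, 1) = t.clusters[p] := List.getD_eq_getElem _ _ hp
  have hsgn : (instantiate t.clusters 1).map Prod.fst
      = (instantiate (decAt t.clusters p) N).map Prod.fst := by
    rw [map_fst_instantiate, map_fst_instantiate, decAt, List.map_set, hgetD]
    have : t.clusters[p].1 = (t.clusters.map Prod.fst)[p]'(by simpa using hp) := by simp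
    rw [this, List.set_getElem_self]
  have key := (forall₂_le_of_blockWord_sublist (instantiate_pos t.pos)
    (by rw [map_fst_instantiate]; exact isChain_map_fst t) hsgn h).get (i := p)
    (by simpa [instantiate] using hp) (by simpa [instantiate, decAt] using hp)
  have h0 := t.pos _ (List.getElem_mem hp)
  rw [hgetD] at hfin
  simp only [instantiate, decAt, hgetD, List.get_eq_getElem, List.getElem_map,
    List.getElem_set_self] at key
  have h2 := key.2
  generalize t.clusters[p].2 = m at h2 hfin h0
  lift m to ℕ using hfin
  have hm : ((m : ℕ∞) - 1) = ((m - 1 : ℕ) : ℕ∞) := by simp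
  rw [hm] at h2
  simp only [ENat.natCast_ne_top, if_false, ENat.toNat_natCast] at h2
  simp only [ne_eq, Nat.cast_eq_zero] at h0
  omega

/-- `g₀ ⊔ ℓ₁ ⊔ g₁ ⊔ ⋯ ⊔ ℓ_k ⊔ g_k`. -/
def interleave {k : ℕ} (ℓ : Fin k → BW) (g : Fin (k + 1) → BW) : BW :=
  g 0 ++ (List.ofFn fun i => ℓ i ++ g i.succ).flatten

lemma sublist_of_interleave (D : SectionData t) {ℓ : Fin D.k → BW} {g : Fin (D.k + 1) → BW}
    (hℓ : ∀ i, ℓ i ∈ Zt (D.T i)) (hg : ∀ j, FitsSigns ((D.A j).map Prod.fst) (g j))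
    (h : (clWord t.clusters 1).Sublist (interleave ℓ g)) :
    (∀ i, (clWord (D.T i).clusters 1).Sublist (ℓ i)) ∧
      ∀ j, (flangeWord (D.A j)).Sublist (g j) := by
  have hpos := instantiate_pos t.pos
  have halt : ((instantiate t.clusters 1).map Prod.fst).IsChain (· ≠ ·) := by
    rw [map_fst_instantiate]
    exact isChain_map_fst t
  have hℓ' (i) : FitsSigns ((instantiate (D.T i).clusters 1).map Prod.fst) (ℓ i) := by
    rw [map_fst_instantiate]
    exact fitsSigns_of_mem_Zcl (hℓ i)
  have hg' (j) : FitsSigns ((instantiate (D.A j) 1).map Prod.fst) (g j) := by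
    rw [map_fst_instantiate]
    exact hg j
  have hseg (i) : FitsSigns ((instantiate (D.T i).clusters 1
      ++ instantiate (D.A i.succ) 1).map Prod.fst) (ℓ i ++ g i.succ) := by
    rw [List.map_append]
    exact (hℓ' i).append (hg' i.succ)
  rw [clWord_eq_blockWord] at h
  rw [D.concat, instantiate_append, instantiate_flatten_ofFn] at h hpos halt
  simp only [instantiate_append] at h hpos halt
  rw [blockWord_append] at h
  have h0 := blockWord_sublist_append hpos halt (hg' 0)
    (by rw [map_flatten_ofFn]; exact FitsSigns.flatten_ofFn hseg) h
  have hpos' := fun c hc => hpos c (List.mem_append_right _ hc)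
  have halt' := (List.isChain_append.1 (List.map_append ▸ halt)).2.1
  have h1 (i) := blockWord_sublist_of_flatten hpos' halt' hseg h0.2 i
  have h2 (i : Fin D.k) := by
    have hmem : instantiate (D.T i).clusters 1 ++ instantiate (D.A i.succ) 1
        <:+: (List.ofFn fun i => instantiate (D.T i).clusters 1
          ++ instantiate (D.A i.succ) 1).flatten :=
      List.infix_of_mem_flatten (List.mem_ofFn.2 ⟨i, rfl⟩)
    have hi := h1 i
    rw [blockWord_append] at hi
    exact blockWord_sublist_append (fun c hc => hpos' c (hmem.subset hc))
      (halt'.infix (hmem.map Prod.fst)) (hℓ' i) (hg' i.succ) hi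
  simp only [flangeWord_eq_clWord (D.finA _) 1, clWord_eq_blockWord]
  exact ⟨fun i => (h2 i).1, Fin.cases h0.1 fun i => (h2 i).2⟩

lemma exists_interleave (D : SectionData t) {w : List ℝ} (hlen : w.length = t.numInf) {μ : BW}
    (h : μ ∈ Zcl (itemClusters (items D w))) :
    ∃ (ℓ : Fin D.k → BW) (g : Fin (D.k + 1) → BW), μ = interleave ℓ g ∧
      (∀ i, ℓ i ∈ Zt (D.T i)) ∧ ∀ j, FitsSigns ((D.A j).map Prod.fst) (g j) := by
  obtain ⟨N, h⟩ := h
  rw [itemClusters_items D hlen, clWord_append, clWord_flatten_ofFn,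
    List.sublist_append_iff] at h
  obtain ⟨g₀, y, rfl, h₀, h⟩ := h
  obtain ⟨y, rfl, hy⟩ := exists_of_sublist_flatten_ofFn h
  simp only [clWord_append] at hy
  have hsplit (i) := List.sublist_append_iff.1 (hy i)
  choose ℓ g hy hℓ hg using hsplit
  have hfit {y j} (h : y.Sublist (clWord (inflate (D.A j)) N)) :
      FitsSigns ((D.A j).map Prod.fst) y := by
    rw [← map_fst_inflate]
    exact fitsSigns_of_mem_Zcl ⟨N, h⟩
  exact ⟨ℓ, Fin.cons g₀ g, by simp [interleave, funext hy], fun i => ⟨N, hℓ i⟩,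
    Fin.cases (hfit h₀) fun i => hfit (hg i)⟩

lemma sublist_flatten_ofFn {α : Type*} {k : ℕ} {f f' : Fin k → List α}
    (h : ∀ i, (f i).Sublist (f' i)) : (List.ofFn f).flatten.Sublist (List.ofFn f').flatten := by
  induction k with
  | zero => simp
  | succ k ih =>
    simp only [List.ofFn_succ, List.flatten_cons]
    exact (h 0).append (ih fun i => h i.succ)

lemma mem_Zt_of_decompOf {D : SectionData t} {μ : BW} {ℓ : Fin D.k → BW}
    (h : decompOf D μ ℓ) : μ ∈ Zt t := by
  obtain ⟨hℓ, rfl⟩ := h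
  choose N hN using hℓ
  refine ⟨Finset.univ.sup N, ?_⟩
  rw [D.concat, clWord_append, clWord_flatten_ofFn, assemble, ← flangeWord_eq_clWord (D.finA 0)]
  refine List.Sublist.append_left ?_ _
  simp only [clWord_append, ← flangeWord_eq_clWord (D.finA _)]
  exact sublist_flatten_ofFn fun i =>
    ((hN i).trans (clWord_mono _ (Finset.le_sup (Finset.mem_univ i)))).append_right _

/-- Blocks of equal signs with increasing multiplicities. -/
abbrev BlockLE : List (Bool × ℕ) → List (Bool × ℕ) → Prop :=
  List.Forall₂ fun c c' => c.1 = c'.1 ∧ c.2 ≤ c'.2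

lemma BlockLE.map_fst_eq {S S' : List (Bool × ℕ)} (h : BlockLE S S') :
    S.map Prod.fst = S'.map Prod.fst := by
  induction h with
  | nil => rfl
  | cons h _ ih => rw [List.map_cons, List.map_cons, h.1, ih]

lemma exists_blockLE_of_sublist {S : List (Bool × ℕ)} {y : BW} (h : y.Sublist (blockWord S)) :
    ∃ S', BlockLE S' S ∧ y = blockWord S' := by
  induction S generalizing y with
  | nil => exact ⟨[], .nil, by simpa using h⟩
  | cons c S ih =>
    rw [blockWord_cons, List.sublist_append_iff] at h
    obtain ⟨l₁, l₂, rfl, h₁, h₂⟩ := h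
    obtain ⟨n, hn, rfl⟩ := List.sublist_replicate_iff.1 h₁
    obtain ⟨S', hS', rfl⟩ := ih h₂
    exact ⟨(c.1, n) :: S', .cons ⟨rfl, hn⟩ hS', by simp⟩

lemma exists_itemWord_eq_blockWord {N : ℕ} {J : List Item} {S : List (Bool × ℕ)}
    (h₁ : BlockLE (instantiate (itemClusters J) 1) S)
    (h₂ : BlockLE S (instantiate (itemClusters J) N)) :
    ∃ L : List (Item × ℕ), L.map Prod.fst = J ∧ itemWord L = blockWord S := by
  induction J generalizing S with
  | nil =>
    obtain rfl : S = [] := by simpa [itemClusters, instantiate] using h₁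
    exact ⟨[], rfl, rfl⟩
  | cons a J ih =>
    cases J with
    | nil =>
      simp only [itemClusters, instantiate, List.map_cons, List.map_nil] at h₁
      obtain _ | ⟨⟨hs, hq⟩, _ | _⟩ := h₁
      rename_i c
      obtain ⟨s, q⟩ := c
      simp only [if_true] at hs hq
      refine ⟨[(a, q - 1)], rfl, ?_⟩
      simp [itemWord, tailWord, hs, Nat.sub_add_cancel hq]
    | cons b J =>
      have hcl : instantiate (itemClusters (a :: b :: J)) = fun n =>
          (a.sgn, n) :: ((a.sep b).map fun s => (s, 1)) ++ instantiate (itemClusters (b :: J)) n := by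
        funext n
        simp [itemClusters, instantiate]
      simp only [hcl, List.cons_append] at h₁ h₂
      obtain _ | @⟨_, ⟨s, q⟩, _, S, ⟨hs, hq⟩, h₁⟩ := h₁
      simp only at hs hq
      subst hs
      obtain _ | ⟨-, h₂⟩ := h₂
      obtain ⟨S', hS, h₁', h₂'⟩ : ∃ S', blockWord S = a.sep b ++ blockWord S' ∧
          BlockLE (instantiate (itemClusters (b :: J)) 1) S' ∧
          BlockLE S' (instantiate (itemClusters (b :: J)) N) := by
        unfold Item.sep at h₁ h₂ ⊢
        split_ifs at h₁ h₂ ⊢ with hc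
        · simp only [List.map_cons, List.map_nil, List.cons_append, List.nil_append] at h₁ h₂
          obtain _ | @⟨_, ⟨s, q⟩, _, S, ⟨hs, hq⟩, h₁⟩ := h₁
          obtain _ | ⟨⟨-, hq'⟩, h₂⟩ := h₂
          simp only at hs hq hq'
          obtain rfl : q = 1 := le_antisymm hq' hq
          exact ⟨S, by simp [← hs], h₁, h₂⟩
        · exact ⟨S, rfl, h₁, h₂⟩
      obtain ⟨L, hL, hw⟩ := ih h₁' h₂'
      refine ⟨(a, q - 1) :: L, by rw [List.map_cons, hL], ?_⟩
      obtain _ | ⟨⟨b', e⟩, L⟩ := L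
      · simp at hL
      obtain rfl : b' = b := by simpa using (List.cons.inj hL).1
      rw [blockWord_cons, hS, ← hw]
      simp [itemWord, tailWord, Nat.sub_add_cancel hq]

lemma itemWord_cons_of_flange {a : Item × ℕ} {L : List (Item × ℕ)}
    (ha : a.1.inSection = false) :
    itemWord (a :: L) = List.replicate (a.2 + 1) a.1.sgn ++ itemWord L := by
  cases L <;> simp [itemWord, tailWord, Item.sep, ha]

lemma exists_flange_itemWord_eq_blockWord {A : List (Bool × ℕ∞)} {S : List (Bool × ℕ)}
    (hpos : ∀ c ∈ A, c.2 ≠ 0) (hfin : ∀ c ∈ A, c.2 ≠ ⊤) (h : BlockLE (instantiate A 1) S) :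
    ∃ L : List (Item × ℕ), L.map Prod.fst = A.map (fun c => ⟨c.1, none, c.2.toNat - 1⟩) ∧
      itemWord L = blockWord S ∧ (∀ b ∈ L, b.1.excess ≤ b.2) ∧
      ((∀ b ∈ L, b.2 = b.1.excess) ↔ (blockWord S).length ≤ (flangeWord A).length) := by
  induction A generalizing S with
  | nil =>
    obtain rfl : S = [] := by simpa [instantiate] using h
    exact ⟨[], rfl, rfl, by simp, by simp⟩
  | cons c A ih =>
    obtain _ | @⟨_, ⟨s, q⟩, _, S, ⟨hs, hq⟩, h⟩ := h
    have hc : c.2 ≠ ⊤ := hfin c (by simp)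
    have hc0 : c.2.toNat ≠ 0 := fun h0 =>
      (ENat.toNat_eq_zero.1 h0).elim (hpos c (by simp)) hc
    simp only [if_neg hc] at hs hq
    subst hs
    obtain ⟨L, hL, hw, hle, hiff⟩ :=
      ih (fun c hc => hpos c (by simp [hc])) (fun c hc => hfin c (by simp [hc])) h
    have hlen : (flangeWord A).length ≤ (blockWord S).length := by
      rw [flangeWord_eq_clWord (fun c hc => hfin c (by simp [hc])) 1, clWord_eq_blockWord]
      exact (blockWord_sublist_of_forall₂ h).length_le
    refine ⟨(⟨c.1, none, c.2.toNat - 1⟩, q - 1) :: L, by rw [List.map_cons, List.map_cons, hL],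
      ?_, ?_, ?_⟩
    · rw [itemWord_cons_of_flange rfl, hw, blockWord_cons, Nat.sub_add_cancel (by omega)]
    · simp only [List.forall_mem_cons]
      exact ⟨by omega, hle⟩
    · have hcons : flangeWord (c :: A) = List.replicate c.2.toNat c.1 ++ flangeWord A := rfl
      rw [List.forall_mem_cons, hiff, hcons, blockWord_cons]
      simp only [List.length_append, List.length_replicate]
      omega

lemma exists_sectionItems_itemWord_eq (D : SectionData t) {w : List ℝ}
    (hlen : w.length = t.numInf) {i : Fin D.k} {y : BW} (hy : y ∈ Zt (D.T i))
    (h : (clWord (D.T i).clusters 1).Sublist y) :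
    ∃ L : List (Item × ℕ), L.map Prod.fst = sectionItems D w i ∧ itemWord L = y := by
  obtain ⟨N, hN⟩ := hy
  rw [clWord_eq_blockWord] at hN
  obtain ⟨S, hS, rfl⟩ := exists_blockLE_of_sublist hN
  rw [clWord_eq_blockWord] at h
  rw [← itemClusters_sectionItems D hlen i] at h hS
  refine exists_itemWord_eq_blockWord (forall₂_le_of_blockWord_sublist ?_ ?_ ?_ h) hS
  · rw [itemClusters_sectionItems D hlen]
    exact instantiate_pos (D.T i).pos
  · rw [map_fst_instantiate, itemClusters_sectionItems D hlen]
    exact isChain_map_fst _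
  · rw [hS.map_fst_eq, map_fst_instantiate, map_fst_instantiate]

lemma SectionData.infix_clusters (D : SectionData t) (j : Fin (D.k + 1)) :
    D.A j <:+: t.clusters := by
  rw [D.concat]
  refine Fin.cases (List.prefix_append _ _).isInfix (fun i => ?_) j
  have h : (D.T i).clusters ++ D.A i.succ
      <:+: (List.ofFn fun i => (D.T i).clusters ++ D.A i.succ).flatten :=
    List.infix_of_mem_flatten (List.mem_ofFn.2 ⟨i, rfl⟩)
  exact ((List.suffix_append _ _).isInfix.trans h).trans (List.suffix_append _ _).isInfix

lemma exists_flangeItems_itemWord_eq (D : SectionData t) {j : Fin (D.k + 1)} {y : BW}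
    (hy : FitsSigns ((D.A j).map Prod.fst) y) (h : (flangeWord (D.A j)).Sublist y) :
    ∃ L : List (Item × ℕ), L.map Prod.fst = flangeItems D j ∧ itemWord L = y ∧
      (∀ b ∈ L, b.1.excess ≤ b.2) ∧ ((∀ b ∈ L, b.2 = b.1.excess) ↔ y = flangeWord (D.A j)) := by
  obtain ⟨S, hS, rfl⟩ := hy
  have hpos : ∀ c ∈ D.A j, c.2 ≠ 0 := fun c hc => t.pos c ((D.infix_clusters j).subset hc)
  have h' := h
  rw [flangeWord_eq_clWord (D.finA j) 1, clWord_eq_blockWord] at h'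
  have hle := forall₂_le_of_blockWord_sublist (instantiate_pos hpos)
    (by rw [map_fst_instantiate]; exact (isChain_map_fst t).infix ((D.infix_clusters j).map _))
    (by rw [map_fst_instantiate, hS]) h'
  obtain ⟨L, h1, h2, h3, h4⟩ := exists_flange_itemWord_eq_blockWord hpos (D.finA j) hle
  exact ⟨L, h1, h2, h3, h4.trans ⟨fun hl => (h.eq_of_length_le hl).symm, fun he => by rw [he]⟩⟩

open Classical in
lemma tendsto_Fword_weps (D : SectionData t) {w : List ℝ} (hlen : w.length = t.numInf)
    {ℓ : Fin D.k → BW} {g : Fin (D.k + 1) → BW} (hℓ : ∀ i, ℓ i ∈ Zt (D.T i))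
    (hg : ∀ j, FitsSigns ((D.A j).map Prod.fst) (g j))
    (h : (clWord t.clusters 1).Sublist (interleave ℓ g)) :
    Filter.Tendsto
      (fun ε : ℝ => Fword (weps D w ε) (interleave ℓ g) / ε ^ itemDegree (items D w))
      (nhdsWithin 0 (Set.Ioi 0))
      (nhds ((∏ j, flangeConst (D.A j)) *
        if ∀ j, g j = flangeWord (D.A j) then ∏ i, Fword (vD D w i) (ℓ i) else 0)) := by
  obtain ⟨h1, h2⟩ := sublist_of_interleave D hℓ hg h
  choose T hT hTw using fun i => exists_sectionItems_itemWord_eq D hlen (hℓ i) (h1 i)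
  choose A hA hAw hle hiff using fun j => exists_flangeItems_itemWord_eq D (hg j) (h2 j)
  set L := A 0 ++ (List.ofFn fun i => T i ++ A i.succ).flatten with hL
  have hTk (i) : ∀ b ∈ T i, b.1.inSection = true := fun b hb =>
    inSection_of_mem_sectionItems D w i _ (by rw [← hT i]; exact List.mem_map_of_mem hb)
  have hAk (j) : ∀ b ∈ A j, b.1.inSection = false := fun b hb =>
    inSection_of_mem_flangeItems D j _ (by rw [← hA j]; exact List.mem_map_of_mem hb)
  have hTne (i) : T i ≠ [] := fun h0 => sectionItems_ne_nil D hlen i (by rw [← hT i, h0]; rfl)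
  have hAlen (j) : (A j).length = (D.A j).length := by
    simpa [flangeItems] using congrArg List.length (hA j)
  have hAne (j : Fin (D.k + 1)) (h0 : (j : ℕ) ≠ 0) (hk : (j : ℕ) ≠ D.k) : A j ≠ [] := by
    rw [← List.length_pos_iff_ne_nil, hAlen]
    exact List.length_pos_iff_ne_nil.2 (D.interior_ne j h0 hk)
  have hLfst : L.map Prod.fst = items D w := by
    simp only [hL, items, List.map_append, map_flatten_ofFn, hT, hA]
  have hLw : itemWord L = interleave ℓ g := by
    rw [hL, flatten_splitting rfl (fun _ _ => itemWord_append) A T hAk hTk hTne hAne]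
    simp only [hTw, hAw, interleave]
  have hlim : itemLimit L = (∏ j, flangeConst (D.A j)) *
      if ∀ j, g j = flangeWord (D.A j) then ∏ i, Fword (vD D w i) (ℓ i) else 0 := by
    have hTl (i) : itemLimit (T i) = Fword (vD D w i) (ℓ i) := by
      rw [itemLimit_section (hTne i) 0 (hTk i), hTw, ← map_interval_sectionItems D w 0, ← hT i,
        List.map_map]
      rfl
    have hAl (j) : itemLimit (A j)
        = flangeConst (D.A j) * if g j = flangeWord (D.A j) then 1 else 0 := by
      simp only [itemLimit_flange (hAk j), hiff j, flangeConst, hAlen j]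
    rw [hL, map_splitting rfl (fun _ _ => itemLimit_append) A T hAk hTk hTne hAne,
      List.prod_ofFn, Finset.prod_mul_distrib, mul_left_comm, ← Fin.prod_univ_succ fun j =>
        itemLimit (A j)]
    simp only [hTl, hAl, Finset.prod_mul_distrib, Finset.prod_ite_zero]
    simp only [Finset.mem_univ, true_imp_iff, Finset.prod_const_one]
    split_ifs <;> ring
  have hne : L ≠ [] := by
    intro h0
    have := congrArg List.length (map_fst_itemClusters_items D hlen)
    rw [← hLfst, h0] at this
    exact t.ne (List.length_eq_zero_iff.1 (by simpa [itemClusters] using this.symm))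
  have key := tendsto_Fword hne (by rw [hLfst]; exact isChain_items D hlen) (fun b hb hk => by
    rw [hL, List.mem_append, List.mem_flatten] at hb
    rcases hb with hb | ⟨l, hl, hb⟩
    · exact hle 0 b hb
    · obtain ⟨i, rfl⟩ := List.mem_ofFn.1 hl
      rcases List.mem_append.1 hb with hb | hb
      · exact absurd (hTk i b hb) (by simp [hk])
      · exact hle i.succ b hb)
  rw [hlim, hLw, hLfst] at key
  refine key.congr fun ε => ?_
  rw [← map_interval_items, ← hLfst, List.map_map]
  rfl

end

/-- Proposition 5.3 of the paper.  Let `(t, w)` be a semifinite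
zigzag growth model.  The template `t′` of `w_ε` does not depend on `ε` (so we take
the one of `w_1`).  There exist `n ∈ ℕ` and a constant `C > 0`, depending only on
`(t, w)`, such that for every zigzag `μ ∈ Z(t′)` with `bw(μ) ≥ t[1]` the limit
`lim_{ε→0⁺} ε^{−n} F_μ(w_ε)` exists and `φ_{t,w}(μ) = C · lim_{ε→0⁺} ε^{−n} F_μ(w_ε)`. -/
theorem phiTW_as_limit (t : Template) (hsf : ¬t.IsFiniteTemplate)
    (D : SectionData t) (w : List ℝ) (hlen : w.length = t.numInf)
    (hwpos : ∀ x ∈ w, 0 < x) (hwsum : w.sum = 1) :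
    ∃ (n : ℕ) (C : ℝ), 0 < C ∧
      ∀ μ : BW, μ ∈ Zcl (tuClusters (weps D w 1)) →
        (clWord t.clusters 1).Sublist μ →
        ∃ L : ℝ,
          Filter.Tendsto (fun ε : ℝ => Fword (weps D w ε) μ / ε ^ n)
            (nhdsWithin 0 (Set.Ioi 0)) (nhds L) ∧
          phiTW t D w μ = ENNReal.ofReal (C * L) := by
  have hchain := isChain_items D hlen
  have hc : 0 < ∏ j, flangeConst (D.A j) :=
    Finset.prod_pos fun j _ => pow_pos two_pos _
  refine ⟨itemDegree (items D w), (∏ j, flangeConst (D.A j))⁻¹, inv_pos.2 hc, fun μ hμ h1 => ?_⟩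
  rw [← map_interval_items, tuClusters_map_interval hchain] at hμ
  by_cases hdec : ∃ ℓ, decompOf D μ ℓ
  · obtain ⟨hℓ, hasm⟩ := hdec.choose_spec
    have hμe : μ = interleave hdec.choose fun j => flangeWord (D.A j) := hasm
    have key := tendsto_Fword_weps D hlen hℓ
      (fun j => fitsSigns_of_mem_Zcl (flangeWord_mem_Zcl (D.finA j))) (hμe ▸ h1)
    rw [if_pos fun _ => rfl, ← hμe] at key
    refine ⟨_, key, ?_⟩
    rw [phiTW, if_neg (not_not.2 (mem_Zt_of_decompOf hdec.choose_spec)),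
      if_neg (not_mem_Jt h1), dif_pos hdec, inv_mul_cancel_left₀ hc.ne']
  · obtain ⟨ℓ, g, rfl, hℓ, hg⟩ := exists_interleave D hlen hμ
    have key := tendsto_Fword_weps D hlen hℓ hg h1
    rw [if_neg fun h => hdec ⟨ℓ, hℓ, by simp only [assemble, interleave, h]⟩] at key
    refine ⟨_, key, ?_⟩
    rw [phiTW, if_neg (not_mem_Jt h1), dif_neg hdec, ite_self, mul_zero, mul_zero,
      ENNReal.ofReal_zero]

end Zigzag
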